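/- arXiv:2312.16841 — 2 statements merged into one kernel-verified Lean document; each statement's English description precedes it below -/
import Mathlib

section
/- Let D be a weighted oriented graph consisting of two unbalanced cycles C_m and C_n sharing exactly one vertex v_1, labelled so that E(C_m) = {e_1,…,e_m}, E(C_n) = {e_{m+1},…,e_{m+n}}, e_i is incident with v_i and v_{i+1} for 1 ≤ i ≤ m−1, e_m with v_m and v_1, e_{m+1} with v_1 and v_{m+1}, e_{m+i} with v_{m+i−1} and v_{m+i} for 2 ≤ i ≤ n−1, and e_{m+n} with v_{m+n−1} and v_1. Then the toric ideal I_D is generated by the primitive binomial f_c, where c = (1/d)·( ((−1)^{i+1} p·M_{m−1}(A(C_m)[1|i]))_{i=1}^{m}, ((−1)^{i} q·M_{n−1}(A(C_n)[1|i]))_{i=1}^{n} ) ∈ ℤ^{m+n}, with p = det(A(C_n)), q = det(A(C_m)), and d = gcd( (|p|·M_{m−1}(A(C_m)[1|i]))_{i=1}^{m}, (|q|·M_{n−1}(A(C_n)[1|i]))_{i=1}^{n} ). -/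
open MvPolynomial Finset

noncomputable def binomPlus (K : Type*) [Field K] {ι : Type*} [Fintype ι]
    (b : ι → ℤ) : MvPolynomial ι K :=
  ∏ e, X e ^ (b e).toNat

noncomputable def binomMinus (K : Type*) [Field K] {ι : Type*} [Fintype ι]
    (b : ι → ℤ) : MvPolynomial ι K :=
  ∏ e, X e ^ (-b e).toNat

noncomputable def binom (K : Type*) [Field K] {ι : Type*} [Fintype ι]
    (b : ι → ℤ) : MvPolynomial ι K :=
  binomPlus K b - binomMinus K b

/-- `f_b` is a primitive binomial of the ideal `I`. -/
def IsPrimitiveIn (K : Type*) [Field K] {ι : Type*} [Fintype ι]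
    (I : Ideal (MvPolynomial ι K)) (b : ι → ℤ) : Prop :=
  b ≠ 0 ∧ binom K b ∈ I ∧
    ∀ c : ι → ℤ, c ≠ 0 → binom K c ∈ I →
      binomPlus K c ∣ binomPlus K b → binomMinus K c ∣ binomMinus K b → c = b

/-- The toric ideal of an `n × m` matrix of non-negative integers: the kernel of
`K[e_1,…,e_m] → K[x_1,…,x_n]`, `e_j ↦ ∏ i, x_i ^ (A i j)`. -/
noncomputable def matToricIdeal (K : Type*) [Field K] {n m : ℕ}
    (A : Matrix (Fin n) (Fin m) ℕ) : Ideal (MvPolynomial (Fin m) K) :=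
  RingHom.ker (aeval (R := K)
    (fun j => ∏ i, X i ^ A i j) :
      MvPolynomial (Fin m) K →ₐ[K] MvPolynomial (Fin n) K).toRingHom

theorem binomPlus_eq_monomial (K : Type*) [Field K] {ι : Type*} [Fintype ι] (b : ι → ℤ) :
    binomPlus K b = monomial (Finsupp.equivFunOnFinite.symm fun e => (b e).toNat) 1 := by
  rw [binomPlus, monomial_eq, Finsupp.prod_fintype _ _ (by simp)]
  simp

theorem binomMinus_eq_monomial (K : Type*) [Field K] {ι : Type*} [Fintype ι] (b : ι → ℤ) :
    binomMinus K b = monomial (Finsupp.equivFunOnFinite.symm fun e => (-b e).toNat) 1 := by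
  rw [binomMinus, monomial_eq, Finsupp.prod_fintype _ _ (by simp)]
  simp

theorem binomPlus_dvd_binomPlus_iff (K : Type*) [Field K] {ι : Type*} [Fintype ι] (b c : ι → ℤ) :
    binomPlus K b ∣ binomPlus K c ↔ ∀ e, (b e).toNat ≤ (c e).toNat := by
  rw [binomPlus_eq_monomial, binomPlus_eq_monomial, monomial_dvd_monomial]
  simp [Finsupp.le_def]

theorem binomMinus_dvd_binomMinus_iff (K : Type*) [Field K] {ι : Type*} [Fintype ι]
    (b c : ι → ℤ) :
    binomMinus K b ∣ binomMinus K c ↔ ∀ e, (-b e).toNat ≤ (-c e).toNat := by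
  rw [binomMinus_eq_monomial, binomMinus_eq_monomial, monomial_dvd_monomial]
  simp [Finsupp.le_def]

theorem aeval_monomial_monomial (K : Type*) [Field K] {ι τ : Type*} [Fintype ι]
    (h : ι → τ →₀ ℕ) (u : ι →₀ ℕ) (r : K) :
    aeval (R := K) (fun e => monomial (h e) (1 : K)) (monomial u r) =
      monomial (∑ e, u e • h e) r := by
  rw [aeval_monomial, Finsupp.prod_fintype _ _ (by simp)]
  simp [monomial_pow, ← monomial_sum_one, algebraMap_eq, C_mul_monomial]

theorem X_mul_X_pow_eq_monomial (K : Type*) [Field K] {τ : Type*} (u v : τ) (n : ℕ) :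
    (X u * X v ^ n : MvPolynomial τ K) =
      monomial (Finsupp.single u 1 + Finsupp.single v n) 1 := by
  rw [X_pow_eq_monomial, X, monomial_mul, one_mul]

theorem cast_single_add_single_apply {τ : Type*} [DecidableEq τ] {s t : τ} (hst : s ≠ t) (v : τ)
    (w : τ → ℕ) :
    ((Finsupp.single s 1 + Finsupp.single t (w t) : τ →₀ ℕ) v : ℤ) =
      if s = v then 1 else if t = v then (w v : ℤ) else 0 := by
  rw [Finsupp.add_apply, Finsupp.single_apply, Finsupp.single_apply]
  split_ifs with h₁ h₂ h₂ <;> simp_all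

theorem binom_mem_ker_iff (K : Type*) [Field K] {ι τ : Type*} [Fintype ι]
    (h : ι → τ →₀ ℕ) (b : ι → ℤ) :
    binom K b ∈ RingHom.ker (aeval (R := K) (fun e => monomial (h e) (1 : K))).toRingHom ↔
      ∀ v, ∑ e, b e * (h e v : ℤ) = 0 := by
  have key : ∀ v, ∑ e, b e * (h e v : ℤ) =
      ((∑ e, (b e).toNat * h e v : ℕ) : ℤ) - (∑ e, (-b e).toNat * h e v : ℕ) := by
    intro v
    push_cast
    rw [← Finset.sum_sub_distrib]
    refine Finset.sum_congr rfl fun e _ => ?_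
    rw [← sub_mul]
    congr 1
    omega
  rw [RingHom.mem_ker, binom, map_sub, sub_eq_zero, binomPlus_eq_monomial, binomMinus_eq_monomial]
  change aeval _ _ = aeval _ _ ↔ _
  rw [aeval_monomial_monomial, aeval_monomial_monomial, (monomial_left_injective one_ne_zero).eq_iff,
    Finsupp.ext_iff]
  refine forall_congr' fun v => ?_
  rw [key, sub_eq_zero, Nat.cast_inj]
  simp [Finsupp.finsetSum_apply]

theorem monomial_sub_monomial_mem_span_binom (K : Type*) [Field K] {ι : Type*} [Fintype ι]
    (c : ι → ℤ) (k : ℕ) (u v : ι →₀ ℕ) (huv : ∀ e, (u e : ℤ) - v e = k * c e) (r : K) :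
    monomial u r - monomial v r ∈ Ideal.span {binom K c} := by
  set P : ι →₀ ℕ := Finsupp.equivFunOnFinite.symm fun e => (c e).toNat with hP
  set M : ι →₀ ℕ := Finsupp.equivFunOnFinite.symm fun e => (-c e).toNat with hM
  have hpm : ∀ e, c e = (P e : ℤ) - M e := fun e => by simp [hP, hM]
  have hmul : ∀ e, (u e : ℤ) + (k * M e : ℕ) = v e + (k * P e : ℕ) := fun e => by
    have := huv e
    rw [hpm, mul_sub] at this
    push_cast
    linarith
  have hz : ∀ e, P e = 0 ∨ M e = 0 := fun e => by simp [hP, hM]; omega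
  obtain ⟨s, hs⟩ : ∃ s : ι →₀ ℕ, u = k • P + s := by
    refine exists_add_of_le fun e => ?_
    have := hmul e
    rcases hz e with h | h <;> simp only [h, mul_zero, Finsupp.smul_apply, smul_eq_mul] at this ⊢ <;>
      omega
  have hv : v = k • M + s := by
    ext e
    have := hmul e
    rw [hs] at this
    simp only [Finsupp.add_apply, Finsupp.smul_apply, smul_eq_mul] at this ⊢
    omega
  have hmon : ∀ Q : ι →₀ ℕ, monomial (k • Q + s) r = monomial Q (1 : K) ^ k * monomial s r := by
    intro Q
    rw [monomial_pow, monomial_mul, one_pow, one_mul]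
  rw [hs, hv, hmon, hmon, ← sub_mul, Ideal.mem_span_singleton, binom, binomPlus_eq_monomial,
    binomMinus_eq_monomial]
  exact Dvd.dvd.mul_right (sub_dvd_pow_sub_pow _ _ k) _

/-- A toric ideal whose lattice of relations is generated by a single vector `c` is principal,
generated by `f_c`. -/
theorem ker_eq_span_binom (K : Type*) [Field K] {ι τ : Type*} [Fintype ι]
    (h : ι → τ →₀ ℕ) (c : ι → ℤ)
    (hker : ∀ b : ι → ℤ, (∀ v, ∑ e, b e * (h e v : ℤ) = 0) ↔ ∃ k : ℤ, ∀ e, b e = k * c e) :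
    RingHom.ker (aeval (R := K) (fun e => monomial (h e) (1 : K))).toRingHom =
      Ideal.span {binom K c} := by
  apply le_antisymm
  · intro f hf
    set g : (ι →₀ ℕ) → (τ →₀ ℕ) := fun u => ∑ e, u e • h e with hg
    have hcongr : ∀ u v, g u = g v → ∀ r : K,
        monomial u r - monomial v r ∈ Ideal.span {binom K c} := by
      intro u v huv r
      obtain ⟨k, hk⟩ := (hker fun e => (u e : ℤ) - v e).1 fun x => by
        have := congrArg (fun z : τ →₀ ℕ => ((z x : ℕ) : ℤ)) huv
        simp only [hg, Finsupp.finsetSum_apply, Finsupp.smul_apply, smul_eq_mul] at this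
        push_cast at this
        simp only [sub_mul, Finset.sum_sub_distrib]
        linarith
      obtain ⟨n, rfl | rfl⟩ := k.eq_nat_or_neg
      · exact monomial_sub_monomial_mem_span_binom K c n u v hk r
      · rw [← neg_mem_iff, neg_sub]
        exact monomial_sub_monomial_mem_span_binom K c n v u
          (fun e => by have := hk e; linarith) r
    have hφ : ∑ u ∈ f.support, monomial (g u) (f.coeff u) = 0 := by
      have h0 : aeval (R := K) (fun e => monomial (h e) (1 : K)) f = 0 := hf
      rw [f.as_sum, map_sum] at h0
      simpa only [aeval_monomial_monomial] using h0
    let s : (τ →₀ ℕ) → (ι →₀ ℕ) := Function.invFun g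
    have hs : ∀ u, g (s (g u)) = g u := fun u => Function.invFun_eq ⟨u, rfl⟩
    have hzero : ∑ u ∈ f.support, monomial (s (g u)) (f.coeff u) = 0 := by
      let L := (basisMonomials τ K).constr K fun x => (monomial (s x) (1 : K) : MvPolynomial ι K)
      have hL : ∀ x r, L (monomial x r) = monomial (s x) r := by
        intro x r
        have hx : (monomial x r : MvPolynomial τ K) = r • basisMonomials τ K x := by
          simp [smul_monomial]
        rw [hx, map_smul, Module.Basis.constr_basis, smul_monomial, smul_eq_mul, mul_one]
      simpa [hL] using congrArg L hφ
    rw [← sub_zero f, ← hzero]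
    nth_rewrite 1 [f.as_sum]
    rw [← Finset.sum_sub_distrib]
    exact Ideal.sum_mem _ fun u _ => hcongr _ _ (hs u).symm _
  · rw [Ideal.span_singleton_le_iff_mem, binom_mem_ker_iff]
    exact (hker c).2 ⟨1, by simp⟩

theorem isPrimitiveIn_ker (K : Type*) [Field K] {ι τ : Type*} [Fintype ι]
    (h : ι → τ →₀ ℕ) (c : ι → ℤ) (hc : c ≠ 0)
    (hker : ∀ b : ι → ℤ, (∀ v, ∑ e, b e * (h e v : ℤ) = 0) ↔ ∃ k : ℤ, ∀ e, b e = k * c e) :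
    IsPrimitiveIn K (RingHom.ker (aeval (R := K) (fun e => monomial (h e) (1 : K))).toRingHom)
      c := by
  refine ⟨hc, (binom_mem_ker_iff K h c).2 ((hker c).2 ⟨1, by simp⟩), fun b hb hmem hp hm => ?_⟩
  obtain ⟨k, hk⟩ := (hker b).1 ((binom_mem_ker_iff K h b).1 hmem)
  rw [binomPlus_dvd_binomPlus_iff] at hp
  rw [binomMinus_dvd_binomMinus_iff] at hm
  obtain ⟨e, he⟩ := Function.ne_iff.1 hc
  have hpe := hp e
  have hme := hm e
  rw [hk] at hpe hme
  have hk0 : k ≠ 0 := by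
    rintro rfl
    exact hb (funext fun e => by simp [hk])
  have hk1 : k = 1 := by
    simp only [Pi.zero_apply] at he
    rcases lt_or_gt_of_ne hk0 with hk' | hk' <;> rcases lt_or_gt_of_ne he with he' | he'
    · have : 0 < k * c e := mul_pos_of_neg_of_neg hk' he'
      omega
    · have : k * c e < 0 := mul_neg_of_neg_of_pos hk' he'
      omega
    · have : -(k * c e) ≤ -c e := by omega
      nlinarith
    · have : k * c e ≤ c e := by omega
      nlinarith
  exact funext fun e => by rw [hk, hk1, one_mul]

theorem mulVec_adjugate_col_zero {n : ℕ} (M : Matrix (Fin (n + 1)) (Fin (n + 1)) ℤ)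
    (i : Fin (n + 1)) :
    ∑ j, M i j * ((-1) ^ (j : ℕ) * (M.submatrix Fin.succ j.succAbove).det) =
      if i = 0 then M.det else 0 := by
  have := congrFun (congrFun M.mul_adjugate i) 0
  rw [Matrix.mul_apply] at this
  simpa [Matrix.adjugate_fin_succ_eq_det_submatrix, Matrix.one_apply, Fin.succAbove_zero] using this

theorem det_mul_eq_of_mulVec_eq_single {n : ℕ} (M : Matrix (Fin (n + 1)) (Fin (n + 1)) ℤ)
    (x : Fin (n + 1) → ℤ) (hx : ∀ i, i ≠ 0 → ∑ j, M i j * x j = 0) (j : Fin (n + 1)) :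
    M.det * x j = (∑ l, M 0 l * x l) *
      ((-1) ^ (j : ℕ) * (M.submatrix Fin.succ j.succAbove).det) := by
  have h1 : M.mulVec x = Pi.single 0 (∑ l, M 0 l * x l) := by
    ext i
    by_cases hi : i = 0
    · subst hi; simp [Matrix.mulVec, dotProduct]
    · simp [hi, Matrix.mulVec, dotProduct, hx i hi]
  have h2 := congrFun (congrArg M.adjugate.mulVec h1) j
  rw [Matrix.mulVec_mulVec, Matrix.adjugate_mul, Matrix.smul_mulVec, Matrix.one_mulVec,
    Matrix.mulVec_single] at h2
  simpa [Matrix.adjugate_fin_succ_eq_det_submatrix, Fin.succAbove_zero, mul_comm] using h2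

theorem exists_submatrix_det_ne_zero {n : ℕ} (M : Matrix (Fin (n + 1)) (Fin (n + 1)) ℤ)
    (hM : M.det ≠ 0) : ∃ j : Fin (n + 1), (M.submatrix Fin.succ j.succAbove).det ≠ 0 := by
  by_contra! h
  apply hM
  have := mulVec_adjugate_col_zero M 0
  simp only [h] at this
  simpa using this.symm

theorem Fin.sum_univ_of_add_eq {M : Type*} [AddCommMonoid M] {m n k : ℕ} (h : m + n = k)
    (hm : m ≤ k) (f : Fin k → M) :
    ∑ t, f t = ∑ i, f (Fin.castLE hm i) + ∑ j, f (Fin.cast h (Fin.natAdd m j)) := by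
  subst h
  exact Fin.sum_univ_add f

theorem Int.dvd_mul_gcd_of_forall_dvd_mul {α β : Type*} (S : Finset α) (T : Finset β)
    (f : α → ℤ) (g : β → ℤ) (D s : ℤ)
    (hf : ∀ i ∈ S, D ∣ s * f i) (hg : ∀ j ∈ T, D ∣ s * g j) :
    D ∣ s * (Nat.gcd (S.gcd fun i => (f i).natAbs) (T.gcd fun j => (g j).natAbs) : ℕ) := by
  rw [← Int.natAbs_dvd_natAbs, Int.natAbs_mul, Int.natAbs_natCast, ← Nat.gcd_mul_left]
  refine Nat.dvd_gcd ?_ ?_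
  · have h := Finset.gcd_mul_left (s := S) (f := fun i => (f i).natAbs) (a := s.natAbs)
    rw [normalize_eq] at h
    rw [← h]
    exact Finset.dvd_gcd fun i hi => by
      simpa [Int.natAbs_mul] using Int.natAbs_dvd_natAbs.2 (hf i hi)
  · have h := Finset.gcd_mul_left (s := T) (f := fun i => (g i).natAbs) (a := s.natAbs)
    rw [normalize_eq] at h
    rw [← h]
    exact Finset.dvd_gcd fun i hi => by
      simpa [Int.natAbs_mul] using Int.natAbs_dvd_natAbs.2 (hg i hi)

/-- The integer relations between the columns of two nonsingular blocks glued along their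
first rows are the multiples of a single vector. -/
theorem glued_blocks_relation_iff {a b : ℕ} (M : Matrix (Fin (a + 1)) (Fin (a + 1)) ℤ)
    (N : Matrix (Fin (b + 1)) (Fin (b + 1)) ℤ) (hM : M.det ≠ 0) (hN : N.det ≠ 0)
    (rm : Fin (a + 1) → ℤ) (hrm : ∀ i, rm i = (M.submatrix Fin.succ (Fin.succAbove i)).det)
    (rn : Fin (b + 1) → ℤ) (hrn : ∀ i, rn i = (N.submatrix Fin.succ (Fin.succAbove i)).det)
    (d : ℕ) (hd : d = Nat.gcd (Finset.univ.gcd fun i => (N.det * rm i).natAbs)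
      (Finset.univ.gcd fun i => (M.det * rn i).natAbs)) (hd0 : d ≠ 0)
    (y : Fin (a + 1) → ℤ) (hy : ∀ i, (d : ℤ) * y i = (-1) ^ (i : ℕ) * N.det * rm i)
    (z : Fin (b + 1) → ℤ) (hz : ∀ j, (d : ℤ) * z j = -((-1) ^ (j : ℕ) * M.det * rn j))
    (x : Fin (a + 1) → ℤ) (t : Fin (b + 1) → ℤ) :
    ((∀ i, i ≠ 0 → ∑ l, M i l * x l = 0) ∧ (∀ j, j ≠ 0 → ∑ l, N j l * t l = 0) ∧
      ∑ l, M 0 l * x l + ∑ l, N 0 l * t l = 0) ↔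
    ∃ k : ℤ, (∀ i, x i = k * y i) ∧ ∀ j, t j = k * z j := by
  have hd' : (d : ℤ) ≠ 0 := by exact_mod_cast hd0
  constructor
  · rintro ⟨hx, ht, h0⟩
    have h1 := det_mul_eq_of_mulVec_eq_single M x hx
    have h2 := det_mul_eq_of_mulVec_eq_single N t ht
    set s := ∑ l, M 0 l * x l with hs
    have h0' : ∑ l, N 0 l * t l = -s := by linarith
    simp only [h0', ← hrm, ← hrn] at h1 h2
    have hsq : ∀ n : ℕ, ((-1 : ℤ) ^ n) * (-1) ^ n = 1 := fun n => by rw [← mul_pow]; simp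
    obtain ⟨k, hk⟩ : M.det * N.det ∣ s * d := by
      rw [hd]
      refine Int.dvd_mul_gcd_of_forall_dvd_mul _ _ _ _ _ _ (fun i _ => ?_) fun j _ => ?_
      · exact ⟨(-1) ^ (i : ℕ) * x i, by
          linear_combination (-(-1) ^ (i : ℕ) * N.det) * h1 i - s * N.det * rm i * hsq i⟩
      · exact ⟨-((-1) ^ (j : ℕ) * t j), by
          linear_combination ((-1) ^ (j : ℕ) * M.det) * h2 j - s * M.det * rn j * hsq j⟩
    refine ⟨k, fun i => ?_, fun j => ?_⟩
    · apply mul_left_cancel₀ (mul_ne_zero hM hN)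
      linear_combination N.det * h1 i - s * hy i + y i * hk
    · apply mul_left_cancel₀ (mul_ne_zero hM hN)
      linear_combination M.det * h2 j - s * hz j + z j * hk
  · rintro ⟨k, hx, ht⟩
    have h1 : ∀ i, d * ∑ l, M i l * x l = k * N.det * if i = 0 then M.det else 0 := by
      intro i
      rw [← mulVec_adjugate_col_zero, Finset.mul_sum, Finset.mul_sum]
      refine Finset.sum_congr rfl fun l _ => ?_
      rw [hx, ← hrm]
      linear_combination k * M i l * hy l
    have h2 : ∀ j, d * ∑ l, N j l * t l = -(k * M.det) * if j = 0 then N.det else 0 := by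
      intro j
      rw [← mulVec_adjugate_col_zero, Finset.mul_sum, Finset.mul_sum]
      refine Finset.sum_congr rfl fun l _ => ?_
      rw [ht, ← hrn]
      linear_combination k * N j l * hz l
    refine ⟨fun i hi => ?_, fun j hj => ?_, ?_⟩
    · simpa [hi, hd0] using h1 i
    · simpa [hj, hd0] using h2 j
    · apply mul_left_cancel₀ hd'
      have e1 := h1 0
      have e2 := h2 0
      simp only [if_true] at e1 e2
      linear_combination e1 + e2

/-- Theorem 4.7. Let `D` consist of two unbalanced cycles
`C_m` (`m = a + 1` edges `e_0, …, e_a` on vertices `v_0, …, v_a`) and `C_n`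
(`n = b + 1` edges `e_{a+1}, …, e_{a+b+1}` on vertices `v_0, v_{a+1}, …,
v_{a+b}`) sharing exactly the vertex `v_0`, with the labelling of Notation 4.6
(0-indexed) and arbitrary edge orientations. Then `I_D` is generated by the
primitive binomial `f_c`, where `c` is `1/d` times the vector
`( ((-1)^i p M_{m-1}(A(C_m)[0|i]))_{i<m}, ((-1)^{i+a} q M_{n-1}(A(C_n)[0|i-m]))_{m≤i<m+n} )`,
`p = det A(C_n)`, `q = det A(C_m)`, and `d` the gcd of the absolute values of
all these entries. -/
theorem stmt13 (K : Type*) [Field K] (a b : ℕ) (ha : 2 ≤ a) (hb : 2 ≤ b)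
    (w : Fin (a + b + 1) → ℕ) (hw : ∀ v, 0 < w v)
    (orient : Fin (a + b + 2) → Bool)
    (endA endB : Fin (a + b + 2) → Fin (a + b + 1))
    (hendA : ∀ j, (endA j : ℕ) =
      if (j : ℕ) < a + 1 then (j : ℕ)
      else if (j : ℕ) = a + 1 then 0 else (j : ℕ) - 1)
    (hendB : ∀ j, (endB j : ℕ) =
      if (j : ℕ) < a + 1 then ((j : ℕ) + 1) % (a + 1)
      else if (j : ℕ) = a + b + 1 then 0 else (j : ℕ))
    (src tgt : Fin (a + b + 2) → Fin (a + b + 1))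
    (hsrc : ∀ e, src e = if orient e then endA e else endB e)
    (htgt : ∀ e, tgt e = if orient e then endB e else endA e)
    (I : Ideal (MvPolynomial (Fin (a + b + 2)) K))
    (hI : I = RingHom.ker (aeval (R := K)
      (fun e => X (src e) * X (tgt e) ^ w (tgt e)) :
        MvPolynomial (Fin (a + b + 2)) K →ₐ[K] MvPolynomial (Fin (a + b + 1)) K).toRingHom)
    (A : Matrix (Fin (a + b + 1)) (Fin (a + b + 2)) ℤ)
    (hA : ∀ v e, A v e =
      if src e = v then 1 else if tgt e = v then (w v : ℤ) else 0)
    (Am : Matrix (Fin (a + 1)) (Fin (a + 1)) ℤ)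
    (hAm : ∀ i j, Am i j =
      A (Fin.castLE (by omega) i) (Fin.castLE (by omega) j))
    (An : Matrix (Fin (b + 1)) (Fin (b + 1)) ℤ)
    (hAn : ∀ i j, An i j =
      A (if (i : ℕ) = 0 then ⟨0, by omega⟩ else ⟨a + (i : ℕ), by omega⟩)
        ⟨a + 1 + (j : ℕ), by omega⟩)
    (p q : ℤ) (hp : p = An.det) (hq : q = Am.det)
    (hCmunbal : q ≠ 0) (hCnunbal : p ≠ 0)
    (rm : Fin (a + 1) → ℤ)
    (hrm : ∀ i, rm i = (Am.submatrix Fin.succ (Fin.succAbove i)).det)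
    (rn : Fin (b + 1) → ℤ)
    (hrn : ∀ i, rn i = (An.submatrix Fin.succ (Fin.succAbove i)).det)
    (d : ℕ) (hd : d = Nat.gcd (Finset.univ.gcd fun i => (p * rm i).natAbs)
      (Finset.univ.gcd fun i => (q * rn i).natAbs))
    (c : Fin (a + b + 2) → ℤ)
    (hc : ∀ t : Fin (a + b + 2), c t =
      if h : (t : ℕ) < a + 1 then
        ((-1 : ℤ) ^ (t : ℕ) * p * rm ⟨(t : ℕ), h⟩) / (d : ℤ)
      else
        ((-1 : ℤ) ^ ((t : ℕ) + a) * q * rn ⟨(t : ℕ) - (a + 1), by omega⟩) / (d : ℤ)) :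
    IsPrimitiveIn K I c ∧ I = Ideal.span {binom K c} := by
  have hst : ∀ e, src e ≠ tgt e := by
    intro e he
    have h1 := hendA e
    have h2 := hendB e
    have h3 : (endA e : ℕ) = endB e := by
      rw [hsrc, htgt] at he
      split_ifs at he <;> simp [he]
    rw [h1, h2] at h3
    by_cases h4 : (e : ℕ) < a
    · rw [Nat.mod_eq_of_lt (by omega)] at h3
      split_ifs at h3 <;> omega
    · by_cases h5 : (e : ℕ) = a
      · rw [h5] at h3
        simp at h3
        omega
      · split_ifs at h3 <;> omega
  have hcross : ∀ v e, A v e ≠ 0 → v = endA e ∨ v = endB e := by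
    intro v e hne
    rw [hA, hsrc, htgt] at hne
    clear * - hne
    split_ifs at hne <;> simp_all
  have hcm : ∀ (v : Fin (a + b + 1)) (j : Fin (b + 1)), 0 < (v : ℕ) → (v : ℕ) < a + 1 →
      A v ⟨a + 1 + j, by omega⟩ = 0 := by
    intro v j h0 h1
    by_contra hne
    rcases hcross _ _ hne with h | h
    · have := hendA ⟨a + 1 + j, by omega⟩
      rw [← h] at this
      simp only at this
      split_ifs at this <;> omega
    · have := hendB ⟨a + 1 + j, by omega⟩
      rw [← h] at this
      simp only at this
      split_ifs at this <;> omega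
  have hcn : ∀ (v : Fin (a + b + 1)) (i : Fin (a + 1)), a < (v : ℕ) →
      A v ⟨i, by omega⟩ = 0 := by
    intro v i h0
    by_contra hne
    rcases hcross _ _ hne with h | h
    · have := hendA ⟨i, by omega⟩
      rw [← h] at this
      simp only at this
      split_ifs at this <;> omega
    · have := hendB ⟨i, by omega⟩
      have hmod : ((i : ℕ) + 1) % (a + 1) < a + 1 := Nat.mod_lt _ (Nat.succ_pos a)
      rw [← h] at this
      simp only at this
      split_ifs at this <;> omega
  have hdet : d ≠ 0 := by
    rw [hd]
    intro h0
    obtain ⟨j, hj⟩ := exists_submatrix_det_ne_zero Am (hq ▸ hCmunbal)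
    have := Finset.gcd_eq_zero_iff.1 (Nat.gcd_eq_zero_iff.1 h0).1 j (mem_univ j)
    simp only [Int.natAbs_eq_zero, mul_eq_zero, hCnunbal, false_or] at this
    exact hj (hrm j ▸ this)
  have hdvdm : ∀ i, (d : ℤ) ∣ p * rm i := fun i => by
    rw [Int.natCast_dvd, hd]
    exact (Nat.gcd_dvd_left _ _).trans (Finset.gcd_dvd (mem_univ i))
  have hdvdn : ∀ j, (d : ℤ) ∣ q * rn j := fun j => by
    rw [Int.natCast_dvd, hd]
    exact (Nat.gcd_dvd_right _ _).trans (Finset.gcd_dvd (mem_univ j))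
  have hy : ∀ i : Fin (a + 1),
      (d : ℤ) * c ⟨i, by omega⟩ = (-1) ^ (i : ℕ) * An.det * rm i := by
    intro i
    rw [hc, dif_pos i.2, Int.mul_ediv_cancel' (by rw [mul_assoc]; exact (hdvdm i).mul_left _), hp]
  have hz : ∀ j : Fin (b + 1),
      (d : ℤ) * c ⟨a + 1 + j, by omega⟩ = -((-1) ^ (j : ℕ) * Am.det * rn j) := by
    intro j
    have hj : (⟨a + 1 + j - (a + 1), by omega⟩ : Fin (b + 1)) = j := Fin.ext (by simp)
    have hpow : (-1 : ℤ) ^ (a + 1 + j + a) = -(-1) ^ (j : ℕ) := by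
      rw [show a + 1 + (j : ℕ) + a = 2 * a + (j + 1) by omega, pow_add, pow_mul]
      simp [pow_succ]
    rw [hc, dif_neg (by simp; omega)]
    simp only [hj]
    rw [Int.mul_ediv_cancel' (by rw [mul_assoc]; exact (hdvdn j).mul_left _), hpow, hq]
    ring
  let h : Fin (a + b + 2) → Fin (a + b + 1) →₀ ℕ := fun e =>
    Finsupp.single (src e) 1 + Finsupp.single (tgt e) (w (tgt e))
  have hh : ∀ e v, (h e v : ℤ) = A v e := by
    intro e v
    rw [hA]
    exact cast_single_add_single_apply (hst e) v w
  have hIeq : I = RingHom.ker (aeval (R := K) (fun e => monomial (h e) (1 : K))).toRingHom := by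
    rw [hI, funext fun e => X_mul_X_pow_eq_monomial K (src e) (tgt e) (w (tgt e))]
  have hker : ∀ x : Fin (a + b + 2) → ℤ,
      (∀ v, ∑ e, x e * (h e v : ℤ) = 0) ↔ ∃ k : ℤ, ∀ e, x e = k * c e := by
    intro x
    have hrow : ∀ v, ∑ e, x e * (h e v : ℤ) = ∑ i : Fin (a + 1), A v ⟨i, by omega⟩ * x ⟨i, by omega⟩ +
        ∑ j : Fin (b + 1), A v ⟨a + 1 + j, by omega⟩ * x ⟨a + 1 + j, by omega⟩ := by
      intro v
      simp only [hh, mul_comm (x _)]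
      exact Fin.sum_univ_of_add_eq (m := a + 1) (n := b + 1) (by omega) (by omega) _
    have hM := hq ▸ hCmunbal
    have hN := hp ▸ hCnunbal
    have hblocks := glued_blocks_relation_iff Am An hM hN rm hrm rn hrn d (by rw [hd, hp, hq]) hdet
      (fun i => c ⟨i, by omega⟩) hy (fun j => c ⟨a + 1 + j, by omega⟩) hz
      (fun i => x ⟨i, by omega⟩) (fun j => x ⟨a + 1 + j, by omega⟩)
    have hsplit : ∀ P : Fin (a + b + 2) → Prop, (∀ e, P e) ↔
        (∀ i : Fin (a + 1), P ⟨i, by omega⟩) ∧ ∀ j : Fin (b + 1), P ⟨a + 1 + j, by omega⟩ := by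
      refine fun P => ⟨fun hP => ⟨fun i => hP _, fun j => hP _⟩, fun hP e => ?_⟩
      by_cases he : (e : ℕ) < a + 1
      · exact hP.1 ⟨e, he⟩
      · have := hP.2 ⟨e - (a + 1), by omega⟩
        convert this using 1
        exact Fin.ext (by simp; omega)
    simp only [hsplit fun e => x e = _ * c e]
    rw [← hblocks]
    have hrow0 : ∑ e, x e * (h e 0 : ℤ) = ∑ l, Am 0 l * x ⟨l, by omega⟩ +
        ∑ l, An 0 l * x ⟨a + 1 + l, by omega⟩ := by
      rw [hrow]
      simp only [hAm, hAn]
      rfl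
    have hrowm : ∀ i : Fin (a + 1), i ≠ 0 → ∑ e, x e * (h e ⟨i, by omega⟩ : ℤ) =
        ∑ l, Am i l * x ⟨l, by omega⟩ := by
      intro i hi
      have hi' : 0 < (i : ℕ) := Nat.pos_of_ne_zero (Fin.val_ne_zero_iff.2 hi)
      rw [hrow]
      simp only [hAm, hcm ⟨i, by omega⟩ _ hi' i.2, zero_mul, sum_const_zero, add_zero]
      rfl
    have hrown : ∀ j : Fin (b + 1), j ≠ 0 → ∑ e, x e * (h e ⟨a + j, by omega⟩ : ℤ) =
        ∑ l, An j l * x ⟨a + 1 + l, by omega⟩ := by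
      intro j hj
      have hj' : (j : ℕ) ≠ 0 := Fin.val_ne_zero_iff.2 hj
      rw [hrow]
      have ha' : a < a + (j : ℕ) := by omega
      simp only [hAn, hj', if_false, hcn ⟨a + j, by omega⟩ _ ha', zero_mul,
        sum_const_zero, zero_add]
    constructor
    · intro hx
      exact ⟨fun i hi => (hrowm i hi).symm.trans (hx _), fun j hj => (hrown j hj).symm.trans (hx _),
        hrow0.symm.trans (hx 0)⟩
    · rintro ⟨hm, hn, h0⟩ v
      by_cases hv0 : v = 0
      · rw [hv0, hrow0, h0]
      · have hv0' : (v : ℕ) ≠ 0 := Fin.val_ne_zero_iff.2 hv0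
        by_cases hva : (v : ℕ) < a + 1
        · have hi : (⟨v, hva⟩ : Fin (a + 1)) ≠ 0 := fun he => hv0' (congrArg Fin.val he)
          exact (hrowm _ hi).trans (hm _ hi)
        · have hj : (⟨v - a, by omega⟩ : Fin (b + 1)) ≠ 0 := fun he => by
            have := congrArg Fin.val he
            simp at this
            omega
          have := (hrown _ hj).trans (hn _ hj)
          convert this using 5
          exact Fin.ext (by simp; omega)
  have hc0 : c ≠ 0 := by
    rintro rfl
    obtain ⟨j, hj⟩ := exists_submatrix_det_ne_zero Am (hq ▸ hCmunbal)
    have := hy j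
    rw [← hrm] at hj
    rw [← hp] at this
    simp [hCnunbal, hj] at this
  rw [hIeq]
  exact ⟨isPrimitiveIn_ker K h c hc0 hker, ker_eq_span_binom K h c hker⟩
end

section
/- Let D be a weighted oriented graph consisting of two unbalanced cycles C_m and C_n sharing a path P of length k ≥ 1, with E(P) = {e_1,…,e_k}, E(C_m) = {e_1,…,e_k, e_{k+1},…,e_m}, E(C_n) = {e_1,…,e_k, e_{m+1},…,e_{m+n−k}}, and let C denote the outer cycle with edge set (E(C_m) ∪ E(C_n)) \ E(P). Suppose the outer cycle C is unbalanced. Then I_D is generated by the primitive binomial f_c, where c = (1/d)·( ((−1)^{i+1} s·r_i)_{i=1}^{k}, ((−1)^{i+m−k+1} p·r_{k+i})_{i=1}^{m−k}, ((−1)^{i+m−k} q·r_{m+i})_{i=1}^{n−k} ) ∈ ℤ^{m+n−k}, with r_i = M_{k−1}(A(P)[1,k+1|i]) for 1 ≤ i ≤ k, r_{k+i} = M_{m−k−1}(A(C_m∖P)[1,m−k+1|i]) for 1 ≤ i ≤ m−k, r_{m+i} = M_{n−k−1}(A(C_n∖P)[1,n−k+1|i]) for 1 ≤ i ≤ n−k,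 q = det(A(C_m)), p = det(A(C_n)), s = det(A(C)), and d = gcd( (|s|·r_i)_{i=1}^{k}, (|p|·r_{k+i})_{i=1}^{m−k}, (|q|·r_{m+i})_{i=1}^{n−k} ). -/
open MvPolynomial Finset

section Toric

variable {K : Type*} [Field K] {E V : Type*} [Fintype E]

theorem aeval_monomial_one_monomial (m : E → V →₀ ℕ) (u : E →₀ ℕ) (a : K) :
    aeval (R := K) (fun e => (monomial (m e) 1 : MvPolynomial V K)) (monomial u a) =
      monomial (∑ e, u e • m e) a := by
  rw [aeval_monomial, Finsupp.prod_fintype _ _ (by simp), algebraMap_eq]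
  simp only [monomial_pow, one_pow]
  have h : ∀ s : Finset E, ∏ e ∈ s, (monomial (u e • m e) 1 : MvPolynomial V K) =
      monomial (∑ e ∈ s, u e • m e) 1 := fun s => (monomial_sum_one s _).symm
  rw [h, C_mul_monomial, mul_one]

/-- If two exponent vectors differ by a multiple of `c`, the corresponding monomials are congruent
modulo the binomial of `c`. -/
theorem monomial_sub_monomial_mem_span_binom_s15 {c : E → ℤ} {u v : E →₀ ℕ} {z : ℤ}
    (h : ∀ e, (u e : ℤ) - v e = z * c e) :
    (monomial u 1 - monomial v 1 : MvPolynomial E K) ∈ Ideal.span {binom K c} := by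
  wlog hz : 0 ≤ z generalizing u v z
  · rw [← neg_sub]
    refine neg_mem (this (u := v) (v := u) (z := -z) (fun e => ?_) (by omega))
    linarith [h e]
  lift z to ℕ using hz
  rw [Ideal.mem_span_singleton, binom, binomPlus_eq_monomial, binomMinus_eq_monomial]
  set P : E →₀ ℕ := Finsupp.equivFunOnFinite.symm fun e => (c e).toNat
  set M : E →₀ ℕ := Finsupp.equivFunOnFinite.symm fun e => (-c e).toNat
  have hle : z • P ≤ u := by
    intro e
    have hP : ((P e : ℕ) : ℤ) = max (c e) 0 := by simp [P]
    have : ((z • P) e : ℤ) ≤ u e := by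
      simp only [Finsupp.smul_apply, smul_eq_mul]
      push_cast
      rw [hP]
      have := h e
      rcases le_total (c e) 0 with h0 | h0
      · rw [max_eq_right h0]; simp
      · rw [max_eq_left h0]; linarith [Int.natCast_nonneg (v e)]
    exact_mod_cast this
  have hu : u = z • P + (u - z • P) := (add_tsub_cancel_of_le hle).symm
  have hv : v = z • M + (u - z • P) := by
    ext e
    have hP : ((P e : ℕ) : ℤ) - M e = c e := by
      simp [P, M]
    have h1 := h e
    have h2 := DFunLike.congr_fun hu e
    simp only [Finsupp.add_apply, Finsupp.smul_apply, smul_eq_mul] at h2 ⊢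
    zify at h2 ⊢
    rw [← hP] at h1
    linarith
  generalize u - z • P = g at hu hv
  rw [hu, hv, ← one_mul (1 : K), ← monomial_mul, ← monomial_mul, ← sub_mul]
  refine Dvd.dvd.mul_right ?_ _
  have := sub_dvd_pow_sub_pow (monomial P 1 : MvPolynomial E K) (monomial M 1) z
  simpa [monomial_pow] using this

theorem sum_smul_eq_iff (m : E → V →₀ ℕ) (u v : E →₀ ℕ) :
    ∑ e, u e • m e = ∑ e, v e • m e ↔ ∀ x, ∑ e, (m e x : ℤ) * ((u e : ℤ) - v e) = 0 := by
  rw [Finsupp.ext_iff]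
  refine forall_congr' fun x => ?_
  simp only [Finsupp.coe_finsetSum, Finset.sum_apply, Finsupp.smul_apply, smul_eq_mul, mul_sub,
    Finset.sum_sub_distrib, sub_eq_zero]
  rw [← Nat.cast_inj (R := ℤ)]
  push_cast
  simp only [mul_comm]

/-- A toric ideal whose lattice of relations is generated by a single vector `c` is generated by
the binomial of `c`, which is primitive. -/
theorem isPrimitiveIn_and_ker_eq_span_binom (m : E → V →₀ ℕ) (c : E → ℤ) (hc : c ≠ 0)
    (hker : ∀ b : E → ℤ, (∀ x, ∑ e, (m e x : ℤ) * b e = 0) ↔ ∃ z : ℤ, ∀ e, b e = z * c e)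
    (I : Ideal (MvPolynomial E K))
    (hI : I = RingHom.ker (aeval (R := K)
      (fun e => (monomial (m e) 1 : MvPolynomial V K))).toRingHom) :
    IsPrimitiveIn K I c ∧ I = Ideal.span {binom K c} := by
  have hmem : ∀ b : E → ℤ, binom K b ∈ I ↔ ∃ z : ℤ, ∀ e, b e = z * c e := by
    intro b
    rw [← hker, hI, RingHom.mem_ker]
    simp only [AlgHom.toRingHom_eq_coe, RingHom.coe_coe]
    rw [binom, map_sub, binomPlus_eq_monomial,
      binomMinus_eq_monomial, aeval_monomial_one_monomial, aeval_monomial_one_monomial, sub_eq_zero,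
      (monomial_left_injective (one_ne_zero (α := K))).eq_iff, sum_smul_eq_iff]
    simp
  have hcI : binom K c ∈ I := (hmem c).2 ⟨1, by simp⟩
  refine ⟨⟨hc, hcI, fun b hb hbI hp hm => ?_⟩, le_antisymm ?_ ?_⟩
  · obtain ⟨z, hz⟩ := (hmem b).1 hbI
    rw [binomPlus_eq_monomial, binomPlus_eq_monomial, monomial_dvd_monomial] at hp
    rw [binomMinus_eq_monomial, binomMinus_eq_monomial, monomial_dvd_monomial] at hm
    have hp' := fun e => (hp.1.resolve_left one_ne_zero) e
    have hm' := fun e => (hm.1.resolve_left one_ne_zero) e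
    simp only [Finsupp.equivFunOnFinite_symm_apply_apply] at hp' hm'
    have hz0 : z ≠ 0 := by
      rintro rfl
      exact hb (funext fun e => by simp [hz])
    obtain ⟨e, he⟩ := Function.ne_iff.1 hc
    simp only [Pi.zero_apply] at he
    have h1 := hp' e
    have h2 := hm' e
    rw [hz] at h1 h2
    have hz1 : z = 1 := by
      rcases lt_trichotomy z 0 with h | h | h
      · exfalso
        rcases lt_or_gt_of_ne he with h' | h'
        · have : 0 < z * c e := mul_pos_of_neg_of_neg h h'
          omega
        · have : z * c e < 0 := mul_neg_of_neg_of_pos h h'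
          omega
      · exact absurd h hz0
      · by_contra h3
        have h4 : 2 ≤ z := by omega
        rcases lt_or_gt_of_ne he with h' | h'
        · have : z * c e ≤ 2 * c e := by nlinarith
          omega
        · have : 2 * c e ≤ z * c e := by nlinarith
          omega
    funext e
    rw [hz, hz1, one_mul]
  · intro f hf
    rw [hI, RingHom.mem_ker] at hf
    classical
    let ψ : (E →₀ ℕ) → (V →₀ ℕ) := fun u => ∑ e, u e • m e
    let L : MvPolynomial V K →ₗ[K] MvPolynomial E K :=
      (basisMonomials V K).constr K fun x => monomial (Function.invFun ψ x) 1
    have hL : ∀ g : MvPolynomial E K,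
        g - L (aeval (fun e => (monomial (m e) 1 : MvPolynomial V K)) g) ∈
          Ideal.span {binom K c} := by
      intro g
      induction g using MvPolynomial.induction_on' with
      | monomial u a =>
        have hLm : L (monomial (ψ u) a) = a • monomial (Function.invFun ψ (ψ u)) 1 := by
          have : (monomial (ψ u) a : MvPolynomial V K) = a • basisMonomials V K (ψ u) := by
            simp [smul_monomial]
          rw [this, map_smul, Module.Basis.constr_basis]
        rw [aeval_monomial_one_monomial]
        change _ - L (monomial (ψ u) a) ∈ _
        have : (monomial u a : MvPolynomial E K) = a • monomial u 1 := by simp [smul_monomial]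
        rw [hLm, this, ← smul_sub]
        have hψ : ψ (Function.invFun ψ (ψ u)) = ψ u := Function.invFun_eq ⟨u, rfl⟩
        obtain ⟨z, hz⟩ := (hker _).1 ((sum_smul_eq_iff m _ _).1 hψ.symm)
        exact Submodule.smul_of_tower_mem _ a (monomial_sub_monomial_mem_span_binom_s15 hz)
      | add g h hg hh =>
        rw [map_add, map_add, add_sub_add_comm]
        exact add_mem hg hh
    have := hL f
    simp only [AlgHom.toRingHom_eq_coe, RingHom.coe_coe] at hf
    rwa [hf, map_zero, sub_zero] at this
  · rw [Ideal.span_singleton_le_iff_mem]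
    exact hcI

end Toric

/-- The determinant of the incidence matrix of a cycle: column `j` has entry `α j` in row `j` and
entry `β j` in the cyclically next row. -/
theorem det_cycle (n : ℕ) (α β : ℕ → ℤ) (M : Matrix (Fin (n + 2)) (Fin (n + 2)) ℤ)
    (hM : ∀ i j, M i j = if (i : ℕ) = j then α j
      else if (i : ℕ) = j + 1 ∨ ((i : ℕ) = 0 ∧ (j : ℕ) = n + 1) then β j else 0) :
    M.det = ∏ j ∈ range (n + 2), α j + (-1) ^ (n + 1) * ∏ j ∈ range (n + 2), β j := by
  rw [Matrix.det_succ_row_zero, Fin.sum_univ_succ, Fin.sum_univ_castSucc]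
  have hz : ∀ j : Fin n, M 0 j.castSucc.succ = 0 := by
    intro j
    rw [hM]
    simp
    omega
  have h1 : (M.submatrix Fin.succ (Fin.succAbove 0)).det = ∏ j ∈ range (n + 1), α (j + 1) := by
    rw [Matrix.det_of_isLowerTriangular, ← Fin.prod_univ_eq_prod_range (fun j => α (j + 1))]
    · refine Finset.prod_congr rfl fun j _ => ?_
      simp [hM]
    · intro i j hij
      have hij : i < j := hij
      rw [Fin.lt_def] at hij
      simp only [Matrix.submatrix_apply, hM, Fin.succAbove_zero, Fin.val_succ]
      rw [if_neg (by omega), if_neg (by omega)]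
  have h2 : (M.submatrix Fin.succ (Fin.succAbove (Fin.last n).succ)).det =
      ∏ j ∈ range (n + 1), β j := by
    rw [Fin.succ_last, Matrix.det_of_isUpperTriangular,
      ← Fin.prod_univ_eq_prod_range (fun j => β j)]
    · refine Finset.prod_congr rfl fun j _ => ?_
      simp [hM]
    · intro i j hij
      have hij : j < i := hij
      rw [Fin.lt_def] at hij
      simp only [Matrix.submatrix_apply, hM, Fin.succAbove_last, Fin.val_succ, Fin.val_castSucc]
      rw [if_neg (by omega), if_neg (by omega)]
  rw [h1, h2, Finset.prod_range_succ' α, Finset.prod_range_succ β (n + 1)]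
  simp only [hz]
  simp only [hM]
  simp
  ring

/-- The coefficient of the `i`-th edge in the relation along a path with `n + 1` edges, where
`α j` and `β j` are the weights of the `j`-th edge at its first and last vertex. -/
def pathCoeff (α β : ℕ → ℤ) (n i : ℕ) : ℤ :=
  (∏ j ∈ range i, β j) * ∏ j ∈ Ico (i + 1) (n + 1), α j

theorem det_path (n : ℕ) (i : Fin (n + 1)) (α β : ℕ → ℤ) (B : Matrix (Fin n) (Fin (n + 1)) ℤ)
    (hB : ∀ t j, B t j = if (j : ℕ) = t then β j else if (j : ℕ) = t + 1 then α j else 0) :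
    (B.submatrix id i.succAbove).det = pathCoeff α β n i := by
  induction n generalizing α β with
  | zero => simp [pathCoeff, Fin.fin_one_eq_zero i]
  | succ n ih =>
    cases i using Fin.cases with
    | zero =>
      rw [Matrix.det_of_isLowerTriangular]
      · simp only [pathCoeff, Fin.val_zero, Finset.range_zero, Finset.prod_empty, one_mul,
          Finset.prod_Ico_eq_prod_range]
        rw [show n + 1 + 1 - (0 + 1) = n + 1 by omega,
          ← Fin.prod_univ_eq_prod_range (fun j => α (0 + 1 + j))]
        refine Finset.prod_congr rfl fun j _ => ?_
        simp [hB, add_comm]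
      · intro i j hij
        have hij : i < j := hij
        rw [Fin.lt_def] at hij
        simp only [Matrix.submatrix_apply, hB, Fin.succAbove_zero, Fin.val_succ, id]
        rw [if_neg (by omega), if_neg (by omega)]
    | succ i =>
      rw [Matrix.det_succ_column_zero, Fin.sum_univ_succ, Finset.sum_eq_zero, add_zero]
      · have key := ih i (fun j => α (j + 1)) (fun j => β (j + 1))
          (B.submatrix Fin.succ Fin.succ) (by intro t j; simp [hB])
        have hsub : (B.submatrix id i.succ.succAbove).submatrix (Fin.succAbove 0) Fin.succ =
            (B.submatrix Fin.succ Fin.succ).submatrix id i.succAbove := by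
          ext t j
          simp
        rw [hsub, key]
        simp only [Matrix.submatrix_apply, Fin.succ_succAbove_zero, hB]
        simp only [pathCoeff, Fin.val_succ, Finset.prod_range_succ' β]
        have : ∏ j ∈ Ico (i.val + 1) (n + 1), α (j + 1) =
            ∏ j ∈ Ico (i.val + 1 + 1) (n + 1 + 1), α j :=
          Finset.prod_Ico_add' α _ _ 1
        rw [this]
        simp
        ring
      · intro t _
        simp [hB]

section PathCoeff

variable {α β : ℕ → ℤ} {n : ℕ}

theorem pathCoeff_mul_eq {t : ℕ} (ht : t < n) :
    β t * pathCoeff α β n t = α (t + 1) * pathCoeff α β n (t + 1) := by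
  simp only [pathCoeff]
  rw [Finset.prod_range_succ, Finset.prod_eq_prod_Ico_succ_bot (show t + 1 < n + 1 by omega)]
  ring

theorem mul_pathCoeff_zero : α 0 * pathCoeff α β n 0 = ∏ j ∈ range (n + 1), α j := by
  simp [pathCoeff, Finset.prod_range_eq_mul_Ico]

theorem mul_pathCoeff_last : β n * pathCoeff α β n n = ∏ j ∈ range (n + 1), β j := by
  simp [pathCoeff, Finset.prod_range_succ, mul_comm]

theorem pathCoeff_ne_zero (hα : ∀ j, α j ≠ 0) (hβ : ∀ j, β j ≠ 0) (i : ℕ) :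
    pathCoeff α β n i ≠ 0 :=
  mul_ne_zero (Finset.prod_ne_zero_iff.2 fun j _ => hβ j)
    (Finset.prod_ne_zero_iff.2 fun j _ => hα j)

theorem pathCoeff_zero_mul_eq (hα : ∀ j, α j ≠ 0) {x : ℕ → ℤ}
    (hx : ∀ t < n, β t * x t + α (t + 1) * x (t + 1) = 0) {t : ℕ} (ht : t ≤ n) :
    pathCoeff α β n 0 * x t = (-1) ^ t * pathCoeff α β n t * x 0 := by
  induction t with
  | zero => simp
  | succ t ih =>
    have h1 := hx t (by omega)
    have h2 := pathCoeff_mul_eq (α := α) (β := β) (n := n) (t := t) (by omega)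
    apply mul_left_cancel₀ (hα (t + 1))
    have h3 := ih (by omega)
    linear_combination pathCoeff α β n 0 * h1 - β t * h3 - (-1) ^ t * x 0 * h2

end PathCoeff

section Theta

/-- First end of the `j`-th edge of two cycles sharing a path. -/
def thetaFst (a k j : ℕ) : ℕ :=
  if j < a + k + 2 then j else if j = a + k + 2 then k + 1 else j - 1

/-- Second end of the `j`-th edge of two cycles sharing a path. -/
def thetaSnd (a b k j : ℕ) : ℕ :=
  if j < a + k + 1 then j + 1 else if j = a + k + 1 then 0
  else if j = a + b + k + 2 then 0 else j

/-- Entry of the incidence matrix of two cycles sharing a path, where the `j`-th edge has weight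
`α j` at its first end and `β j` at its second end. -/
def thetaEntry (a b k : ℕ) (α β : ℕ → ℤ) (v j : ℕ) : ℤ :=
  if thetaFst a k j = v then α j else if thetaSnd a b k j = v then β j else 0

variable {a b k : ℕ} {α β : ℕ → ℤ}

theorem thetaEntry_fst {v j : ℕ} (h : thetaFst a k j = v) : thetaEntry a b k α β v j = α j :=
  if_pos h

theorem thetaEntry_snd {v j : ℕ} (h : thetaFst a k j ≠ v) (h' : thetaSnd a b k j = v) :
    thetaEntry a b k α β v j = β j := by
  rw [thetaEntry, if_neg h, if_pos h']

theorem thetaEntry_zero {v j : ℕ} (h : thetaFst a k j ≠ v) (h' : thetaSnd a b k j ≠ v) :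
    thetaEntry a b k α β v j = 0 := by
  rw [thetaEntry, if_neg h, if_neg h']

/-- Entries of the incidence matrix of the outer cycle, traversed along the left path backwards and
then along the right path. -/
theorem thetaEntry_outer {v e i j : ℕ} (hi : i < a + b + 2) (hj : j < a + b + 2)
    (hv : (i = 0 ∧ v = 0) ∨ (0 < i ∧ i ≤ a + 1 ∧ v = a + k + 2 - i) ∨ (a + 1 < i ∧ v = k + i))
    (he : (j ≤ a ∧ e = a + k + 1 - j) ∨ (a < j ∧ e = k + 1 + j)) :
    thetaEntry a b k α β v e =
      if i = j then if j ≤ a then β (a + k + 1 - j) else α (k + 1 + j)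
      else if i = j + 1 ∨ (i = 0 ∧ j = a + b + 1) then
        if j ≤ a then α (a + k + 1 - j) else β (k + 1 + j)
      else 0 := by
  obtain ⟨f, hf⟩ : ∃ f, thetaFst a k e = f := ⟨_, rfl⟩
  obtain ⟨g, hg⟩ : ∃ g, thetaSnd a b k e = g := ⟨_, rfl⟩
  have hf' : (j ≤ a ∧ f = e) ∨ (j = a + 1 ∧ f = k + 1) ∨ (a + 1 < j ∧ f = e - 1) := by
    rw [← hf, thetaFst]
    split_ifs <;> omega
  have hg' : (j = 0 ∧ g = 0) ∨ (0 < j ∧ j ≤ a ∧ g = e + 1) ∨ (a < j ∧ j = a + b + 1 ∧ g = 0) ∨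
      (a < j ∧ j < a + b + 1 ∧ g = e) := by
    rw [← hg, thetaSnd]
    split_ifs <;> omega
  by_cases h1 : i = j
  · rw [if_pos h1]
    rcases he with ⟨h, rfl⟩ | ⟨h, rfl⟩
    · rw [if_pos h, thetaEntry_snd] <;> omega
    · rw [if_neg (by omega), thetaEntry_fst]
      omega
  rw [if_neg h1]
  by_cases h2 : i = j + 1 ∨ (i = 0 ∧ j = a + b + 1)
  · rw [if_pos h2]
    rcases he with ⟨h, rfl⟩ | ⟨h, rfl⟩
    · rw [if_pos h, thetaEntry_fst]
      omega
    · rw [if_neg (by omega), thetaEntry_snd] <;> omega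
  · rw [if_neg h2, thetaEntry_zero] <;> omega

theorem thetaEntry_left {t j : ℕ} (ht : t < a) (hj : j < a + 1) :
    thetaEntry a b k α β (k + 1 + (t + 1)) (k + 1 + j) =
      if j = t then β (k + 1 + j) else if j = t + 1 then α (k + 1 + j) else 0 := by
  split_ifs with h1 h2
  · apply thetaEntry_snd
    · unfold thetaFst; split_ifs <;> omega
    · unfold thetaSnd; split_ifs <;> omega
  · apply thetaEntry_fst
    unfold thetaFst; split_ifs <;> omega
  · apply thetaEntry_zero
    · unfold thetaFst; split_ifs <;> omega
    · unfold thetaSnd; split_ifs <;> omega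

theorem thetaEntry_right {t j : ℕ} (ht : t < b) :
    thetaEntry a b k α β (a + k + 1 + (t + 1)) (a + k + 2 + j) =
      if j = t then β (a + k + 2 + j) else if j = t + 1 then α (a + k + 2 + j) else 0 := by
  split_ifs with h1 h2
  · apply thetaEntry_snd
    · unfold thetaFst; split_ifs <;> omega
    · unfold thetaSnd; split_ifs <;> omega
  · apply thetaEntry_fst
    unfold thetaFst; split_ifs <;> omega
  · apply thetaEntry_zero
    · unfold thetaFst; split_ifs <;> omega
    · unfold thetaSnd; split_ifs <;> omega

theorem sum_thetaEntry_inner (x : ℕ → ℤ) {v i j : ℕ} (hij : i < j)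
    (hj : j < a + b + k + 3)
    (hv : (v ≠ 0 ∧ v ≤ k ∧ i + 1 = v ∧ j = v) ∨
      (k + 1 < v ∧ v ≤ a + k + 1 ∧ i + 1 = v ∧ j = v) ∨
      (a + k + 2 ≤ v ∧ i = v ∧ j = v + 1)) :
    ∑ e ∈ range (a + b + k + 3), thetaEntry a b k α β v e * x e = β i * x i + α j * x j := by
  rw [← Finset.sum_subset (s₁ := {i, j}), Finset.sum_pair hij.ne,
    thetaEntry_snd, thetaEntry_fst]
  · unfold thetaFst; split_ifs <;> omega
  · unfold thetaFst; split_ifs <;> omega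
  · unfold thetaSnd; split_ifs <;> omega
  · intro e he
    simp only [Finset.mem_insert, Finset.mem_singleton] at he
    rw [Finset.mem_range]
    omega
  · intro e he he'
    simp only [Finset.mem_insert, Finset.mem_singleton, not_or, Finset.mem_range] at he he'
    rw [thetaEntry_zero, zero_mul]
    · unfold thetaFst; split_ifs <;> omega
    · unfold thetaSnd; split_ifs <;> omega

theorem sum_thetaEntry_zero (x : ℕ → ℤ) :
    ∑ e ∈ range (a + b + k + 3), thetaEntry a b k α β 0 e * x e =
      α 0 * x 0 + β (k + 1 + a) * x (k + 1 + a) + β (a + k + 2 + b) * x (a + k + 2 + b) := by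
  rw [← Finset.sum_subset (s₁ := {0, k + 1 + a, a + k + 2 + b}),
    Finset.sum_insert (by simp; omega), Finset.sum_pair (by omega),
    thetaEntry_fst, thetaEntry_snd, thetaEntry_snd]
  · ring
  · unfold thetaFst; split_ifs <;> omega
  · unfold thetaSnd; split_ifs <;> omega
  · unfold thetaFst; split_ifs <;> omega
  · unfold thetaSnd; split_ifs <;> omega
  · unfold thetaFst; split_ifs <;> omega
  · intro e he
    simp only [Finset.mem_insert, Finset.mem_singleton] at he
    rw [Finset.mem_range]
    omega
  · intro e he he'
    simp only [Finset.mem_insert, Finset.mem_singleton, not_or, Finset.mem_range] at he he'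
    rw [thetaEntry_zero, zero_mul]
    · unfold thetaFst; split_ifs <;> omega
    · unfold thetaSnd; split_ifs <;> omega

theorem sum_thetaEntry_branch (x : ℕ → ℤ) :
    ∑ e ∈ range (a + b + k + 3), thetaEntry a b k α β (k + 1) e * x e =
      β k * x k + α (k + 1) * x (k + 1) + α (a + k + 2) * x (a + k + 2) := by
  rw [← Finset.sum_subset (s₁ := {k, k + 1, a + k + 2}),
    Finset.sum_insert (by simp; omega), Finset.sum_pair (by omega),
    thetaEntry_snd, thetaEntry_fst, thetaEntry_fst]
  · ring
  · unfold thetaFst; split_ifs <;> omega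
  · unfold thetaFst; split_ifs <;> omega
  · unfold thetaFst; split_ifs <;> omega
  · unfold thetaSnd; split_ifs <;> omega
  · intro e he
    simp only [Finset.mem_insert, Finset.mem_singleton] at he
    rw [Finset.mem_range]
    omega
  · intro e he he'
    simp only [Finset.mem_insert, Finset.mem_singleton, not_or, Finset.mem_range] at he he'
    rw [thetaEntry_zero, zero_mul]
    · unfold thetaFst; split_ifs <;> omega
    · unfold thetaSnd; split_ifs <;> omega

/-- The linear system satisfied by the kernel vectors of the incidence matrix of two cycles
sharing a path. -/
structure ThetaRelation (a b k : ℕ) (α β x : ℕ → ℤ) : Prop where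
  shared : ∀ t < k, β t * x t + α (t + 1) * x (t + 1) = 0
  left : ∀ t < a, β (k + 1 + t) * x (k + 1 + t) +
    α (k + 1 + (t + 1)) * x (k + 1 + (t + 1)) = 0
  right : ∀ t < b, β (a + k + 2 + t) * x (a + k + 2 + t) +
    α (a + k + 2 + (t + 1)) * x (a + k + 2 + (t + 1)) = 0
  start : α 0 * x 0 + β (k + 1 + a) * x (k + 1 + a) + β (a + k + 2 + b) * x (a + k + 2 + b) = 0
  branch : β k * x k + α (k + 1) * x (k + 1) + α (a + k + 2) * x (a + k + 2) = 0

theorem forall_sum_thetaEntry_eq_zero_iff (x : ℕ → ℤ) :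
    (∀ v < a + b + k + 2, ∑ e ∈ range (a + b + k + 3), thetaEntry a b k α β v e * x e = 0) ↔
      ThetaRelation a b k α β x := by
  constructor
  · intro h
    refine ⟨fun t ht => ?_, fun t ht => ?_, fun t ht => ?_, ?_, ?_⟩
    · rw [← h (t + 1) (by omega), sum_thetaEntry_inner] <;> omega
    · rw [← h (k + 1 + (t + 1)) (by omega), sum_thetaEntry_inner] <;> omega
    · rw [← h (a + k + 2 + t) (by omega), sum_thetaEntry_inner] <;> omega
    · rw [← h 0 (by omega), sum_thetaEntry_zero]
    · rw [← h (k + 1) (by omega), sum_thetaEntry_branch]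
  · rintro ⟨h1, h2, h3, h4, h5⟩ v hv
    by_cases hv0 : v = 0
    · rw [hv0, sum_thetaEntry_zero, h4]
    by_cases hvk : v = k + 1
    · rw [hvk, sum_thetaEntry_branch, h5]
    by_cases hv1 : v ≤ k
    · obtain ⟨t, rfl⟩ := Nat.exists_eq_succ_of_ne_zero hv0
      rw [← h1 t (by omega), sum_thetaEntry_inner] <;> omega
    by_cases hv2 : v ≤ a + k + 1
    · obtain ⟨t, rfl⟩ : ∃ t, v = k + 1 + (t + 1) := ⟨v - (k + 2), by omega⟩
      rw [← h2 t (by omega), sum_thetaEntry_inner] <;> omega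
    · obtain ⟨t, rfl⟩ : ∃ t, v = a + k + 2 + t := ⟨v - (a + k + 2), by omega⟩
      rw [← h3 t (by omega), sum_thetaEntry_inner] <;> omega

namespace ThetaRelation

theorem smul_sub_smul {x y : ℕ → ℤ} (hx : ThetaRelation a b k α β x)
    (hy : ThetaRelation a b k α β y) (r s : ℤ) :
    ThetaRelation a b k α β fun j => r * x j - s * y j where
  shared t ht := by linear_combination r * hx.shared t ht - s * hy.shared t ht
  left t ht := by linear_combination r * hx.left t ht - s * hy.left t ht
  right t ht := by linear_combination r * hx.right t ht - s * hy.right t ht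
  start := by linear_combination r * hx.start - s * hy.start
  branch := by linear_combination r * hx.branch - s * hy.branch

/-- If the outer cycle is unbalanced, a relation is determined by its first entry. -/
theorem eq_zero {x : ℕ → ℤ} (hx : ThetaRelation a b k α β x)
    (hα : ∀ j, α j ≠ 0) (hβ : ∀ j, β j ≠ 0)
    (hs : (∏ j ∈ range (a + 1), β (k + 1 + j)) * ∏ j ∈ range (b + 1), α (a + k + 2 + j) +
      (-1) ^ (a + b + 1) *
        ((∏ j ∈ range (a + 1), α (k + 1 + j)) * ∏ j ∈ range (b + 1), β (a + k + 2 + j)) ≠ 0)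
    (h0 : x 0 = 0) {j : ℕ} (hj : j < a + b + k + 3) : x j = 0 := by
  have hP : ∀ t ≤ k, x t = 0 := fun t ht => by
    have := pathCoeff_zero_mul_eq hα hx.shared ht
    rw [h0, mul_zero] at this
    exact (mul_eq_zero.1 this).resolve_left (pathCoeff_ne_zero hα hβ 0)
  set αl : ℕ → ℤ := fun j => α (k + 1 + j) with hαl
  set βl : ℕ → ℤ := fun j => β (k + 1 + j) with hβl
  set αr : ℕ → ℤ := fun j => α (a + k + 2 + j) with hαr
  set βr : ℕ → ℤ := fun j => β (a + k + 2 + j) with hβr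
  have hl : ∀ t ≤ a, pathCoeff αl βl a 0 * x (k + 1 + t) =
      (-1) ^ t * pathCoeff αl βl a t * x (k + 1) := fun t ht =>
    pathCoeff_zero_mul_eq (x := fun j => x (k + 1 + j)) (fun _ => hα _) hx.left ht
  have hr : ∀ t ≤ b, pathCoeff αr βr b 0 * x (a + k + 2 + t) =
      (-1) ^ t * pathCoeff αr βr b t * x (a + k + 2) := fun t ht =>
    pathCoeff_zero_mul_eq (x := fun j => x (a + k + 2 + j)) (fun _ => hα _) hx.right ht
  have hl0 : pathCoeff αl βl a 0 ≠ 0 := pathCoeff_ne_zero (fun _ => hα _) (fun _ => hβ _) 0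
  have hr0 : pathCoeff αr βr b 0 ≠ 0 := pathCoeff_ne_zero (fun _ => hα _) (fun _ => hβ _) 0
  have e1 := hx.start
  have e2 := hx.branch
  rw [h0] at e1
  rw [hP k le_rfl] at e2
  have l1 : α (k + 1) * pathCoeff αl βl a 0 = _ := mul_pathCoeff_zero (α := αl)
  have l2 : β (k + 1 + a) * pathCoeff αl βl a a = _ := mul_pathCoeff_last (β := βl)
  have r1 : α (a + k + 2) * pathCoeff αr βr b 0 = _ := mul_pathCoeff_zero (α := αr)
  have r2 : β (a + k + 2 + b) * pathCoeff αr βr b b = _ := mul_pathCoeff_last (β := βr)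
  have ha := hl a le_rfl
  have hb := hr b le_rfl
  have hsq : ((-1 : ℤ) ^ a) * (-1) ^ a = 1 := by rw [← mul_pow]; simp
  rw [← l1, ← l2, ← r1, ← r2] at hs
  have hl1 : x (k + 1) = 0 := by
    refine (mul_eq_zero.1 ?_).resolve_left hs
    have : ((-1 : ℤ) ^ (a + b + 1)) = - ((-1) ^ a * (-1) ^ b) := by ring
    rw [this]
    linear_combination (-1) ^ a * α (a + k + 2) * pathCoeff αl βl a 0 * pathCoeff αr βr b 0 * e1 -
      (-1) ^ a * α (a + k + 2) * pathCoeff αr βr b 0 * β (k + 1 + a) * ha -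
      (-1) ^ a * α (a + k + 2) * pathCoeff αl βl a 0 * β (a + k + 2 + b) * hb -
      (-1) ^ a * (-1) ^ b * pathCoeff αl βl a 0 * β (a + k + 2 + b) * pathCoeff αr βr b b * e2 -
      β (k + 1 + a) * pathCoeff αl βl a a * α (a + k + 2) * pathCoeff αr βr b 0 *
        x (k + 1) * hsq
  have hr1 : x (a + k + 2) = 0 := by
    rw [hl1] at e2
    simpa [hα] using e2
  by_cases h1 : j ≤ k
  · exact hP j h1
  by_cases h2 : j ≤ k + 1 + a
  · obtain ⟨t, rfl⟩ := Nat.exists_eq_add_of_le (show k + 1 ≤ j by omega)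
    have := hl t (by omega)
    rw [hl1, mul_zero] at this
    exact (mul_eq_zero.1 this).resolve_left hl0
  · obtain ⟨t, rfl⟩ := Nat.exists_eq_add_of_le (show a + k + 2 ≤ j by omega)
    have := hr t (by omega)
    rw [hr1, mul_zero] at this
    exact (mul_eq_zero.1 this).resolve_left hr0

/-- An explicit relation built from the determinants of the three cycles. -/
theorem of_pathCoeff {x : ℕ → ℤ} {p q s : ℤ}
    (hq : q = (∏ j ∈ range (k + 1), α j) * ∏ j ∈ range (a + 1), α (k + 1 + j) +
      (-1) ^ (a + k + 1) *
        ((∏ j ∈ range (k + 1), β j) * ∏ j ∈ range (a + 1), β (k + 1 + j)))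
    (hp : p = (∏ j ∈ range (k + 1), α j) * ∏ j ∈ range (b + 1), α (a + k + 2 + j) +
      (-1) ^ (b + k + 1) *
        ((∏ j ∈ range (k + 1), β j) * ∏ j ∈ range (b + 1), β (a + k + 2 + j)))
    (hs : s = (∏ j ∈ range (a + 1), β (k + 1 + j)) * ∏ j ∈ range (b + 1), α (a + k + 2 + j) +
      (-1) ^ (a + b + 1) *
        ((∏ j ∈ range (a + 1), α (k + 1 + j)) * ∏ j ∈ range (b + 1), β (a + k + 2 + j)))
    (hxP : ∀ t ≤ k, x t = (-1) ^ t * s * pathCoeff α β k t)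
    (hxl : ∀ t ≤ a, x (k + 1 + t) = (-1) ^ (t + 1 + a) * p *
      pathCoeff (fun j => α (k + 1 + j)) (fun j => β (k + 1 + j)) a t)
    (hxr : ∀ t ≤ b, x (a + k + 2 + t) = (-1) ^ (t + a) * q *
      pathCoeff (fun j => α (a + k + 2 + j)) (fun j => β (a + k + 2 + j)) b t) :
    ThetaRelation a b k α β x := by
  set αl : ℕ → ℤ := fun j => α (k + 1 + j) with hαl
  set βl : ℕ → ℤ := fun j => β (k + 1 + j) with hβl
  set αr : ℕ → ℤ := fun j => α (a + k + 2 + j) with hαr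
  set βr : ℕ → ℤ := fun j => β (a + k + 2 + j) with hβr
  have P1 := mul_pathCoeff_zero (α := α) (β := β) (n := k)
  have P2 := mul_pathCoeff_last (α := α) (β := β) (n := k)
  have l1 : α (k + 1) * pathCoeff αl βl a 0 = _ := mul_pathCoeff_zero (α := αl)
  have l2 : β (k + 1 + a) * pathCoeff αl βl a a = _ := mul_pathCoeff_last (β := βl)
  have r1 : α (a + k + 2) * pathCoeff αr βr b 0 = _ := mul_pathCoeff_zero (α := αr)
  have r2 : β (a + k + 2 + b) * pathCoeff αr βr b b = _ := mul_pathCoeff_last (β := βr)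
  rw [← P1, ← P2, ← l1, ← l2] at hq
  rw [← P1, ← P2, ← r1, ← r2] at hp
  rw [← l1, ← l2, ← r1, ← r2] at hs
  have hsq : ∀ n : ℕ, ((-1 : ℤ) ^ n) * (-1) ^ n = 1 := fun n => by rw [← mul_pow]; simp
  refine ⟨fun t ht => ?_, fun t ht => ?_, fun t ht => ?_, ?_, ?_⟩
  · rw [hxP t ht.le, hxP (t + 1) ht]
    linear_combination (-1) ^ t * s * pathCoeff_mul_eq (α := α) (β := β) ht
  · rw [hxl t ht.le, hxl (t + 1) ht]
    linear_combination (-1) ^ (t + 1 + a) * p * pathCoeff_mul_eq (α := αl) (β := βl) ht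
  · rw [hxr t ht.le, hxr (t + 1) ht]
    linear_combination (-1) ^ (t + a) * q * pathCoeff_mul_eq (α := αr) (β := βr) ht
  · rw [hxP 0 (Nat.zero_le _), hxl a le_rfl, hxr b le_rfl, hp, hq, hs]
    have ha := hsq a
    simp only [pow_succ, pow_add, pow_zero]
    generalize (-1 : ℤ) ^ a = u at *
    generalize (-1 : ℤ) ^ b = v at *
    generalize (-1 : ℤ) ^ k = z at *
    grind
  · have h1 := hxl 0 (Nat.zero_le _)
    have h2 := hxr 0 (Nat.zero_le _)
    rw [add_zero] at h1 h2
    rw [hxP k le_rfl, h1, h2, hp, hq, hs]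
    have ha := hsq a
    have hk := hsq k
    simp only [pow_succ, pow_add, pow_zero]
    generalize (-1 : ℤ) ^ a = u at *
    generalize (-1 : ℤ) ^ b = v at *
    generalize (-1 : ℤ) ^ k = z at *
    grind

end ThetaRelation

end Theta

set_option maxHeartbeats 1000000 in
/-- Theorem 4.12. Let `D` consist of two unbalanced cycles
`C_m` (`m = a0 + k0 + 2`) and `C_n` (`n = b0 + k0 + 2`) sharing a path `P` of
length `k = k0 + 1 ≥ 1` (edges `e_0, …, e_{k0}`), with the labelling of
Notation 4.11 (0-indexed) and arbitrary edge orientations, and suppose the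
outer cycle `C` (edge set `(E(C_m) ∪ E(C_n)) \ E(P)`) is unbalanced. Then
`I_D` is generated by the primitive binomial `f_c`, where `c` is `1/d` times
the vector with blocks `((-1)^i s r_i)`, `((-1)^{i+k0+a0} p r_{k+i})`,
`((-1)^{i+k0} q r_{m+i})` built from the minors
`r_i = M_{k-1}(A(P)[0,k|i])`, `r_{k+i} = M_{m-k-1}(A(C_m∖P)[0,m-k|i])`,
`r_{m+i} = M_{n-k-1}(A(C_n∖P)[0,n-k|i])`, with `q = det A(C_m)`,
`p = det A(C_n)`, `s = det A(C)` and `d` the gcd of the absolute values of all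
the entries. -/
theorem stmt15 (K : Type*) [Field K] (a0 b0 k0 : ℕ)
    (hm3 : 1 ≤ a0 + k0) (hn3 : 1 ≤ b0 + k0) (houter : 1 ≤ a0 + b0)
    (w : Fin (a0 + b0 + k0 + 2) → ℕ) (hw : ∀ v, 0 < w v)
    (orient : Fin (a0 + b0 + k0 + 3) → Bool)
    (endA endB : Fin (a0 + b0 + k0 + 3) → Fin (a0 + b0 + k0 + 2))
    (hendA : ∀ j, (endA j : ℕ) =
      if (j : ℕ) < a0 + k0 + 2 then (j : ℕ)
      else if (j : ℕ) = a0 + k0 + 2 then k0 + 1 else (j : ℕ) - 1)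
    (hendB : ∀ j, (endB j : ℕ) =
      if (j : ℕ) < a0 + k0 + 1 then (j : ℕ) + 1
      else if (j : ℕ) = a0 + k0 + 1 then 0
      else if (j : ℕ) = a0 + b0 + k0 + 2 then 0 else (j : ℕ))
    (src tgt : Fin (a0 + b0 + k0 + 3) → Fin (a0 + b0 + k0 + 2))
    (hsrc : ∀ e, src e = if orient e then endA e else endB e)
    (htgt : ∀ e, tgt e = if orient e then endB e else endA e)
    (I : Ideal (MvPolynomial (Fin (a0 + b0 + k0 + 3)) K))
    (hI : I = RingHom.ker (aeval (R := K)
      (fun e => X (src e) * X (tgt e) ^ w (tgt e)) :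
        MvPolynomial (Fin (a0 + b0 + k0 + 3)) K →ₐ[K]
          MvPolynomial (Fin (a0 + b0 + k0 + 2)) K).toRingHom)
    (A : Matrix (Fin (a0 + b0 + k0 + 2)) (Fin (a0 + b0 + k0 + 3)) ℤ)
    (hA : ∀ v e, A v e =
      if src e = v then 1 else if tgt e = v then (w v : ℤ) else 0)
    (AP : Matrix (Fin (k0 + 2)) (Fin (k0 + 1)) ℤ)
    (hAP : ∀ i j, AP i j =
      A (Fin.castLE (by omega) i) (Fin.castLE (by omega) j))
    (AmP : Matrix (Fin (a0 + 2)) (Fin (a0 + 1)) ℤ)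
    (hAmP : ∀ i j, AmP i j =
      A (if h : (i : ℕ) = a0 + 1 then ⟨0, by omega⟩
          else ⟨k0 + 1 + (i : ℕ), by omega⟩)
        ⟨k0 + 1 + (j : ℕ), by omega⟩)
    (AnP : Matrix (Fin (b0 + 2)) (Fin (b0 + 1)) ℤ)
    (hAnP : ∀ i j, AnP i j =
      A (if h : (i : ℕ) = b0 + 1 then ⟨0, by omega⟩
          else if h0 : (i : ℕ) = 0 then ⟨k0 + 1, by omega⟩
          else ⟨a0 + k0 + 1 + (i : ℕ), by omega⟩)
        ⟨a0 + k0 + 2 + (j : ℕ), by omega⟩)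
    (Am : Matrix (Fin (a0 + k0 + 2)) (Fin (a0 + k0 + 2)) ℤ)
    (hAm : ∀ i j, Am i j =
      A (Fin.castLE (by omega) i) (Fin.castLE (by omega) j))
    (An : Matrix (Fin (b0 + k0 + 2)) (Fin (b0 + k0 + 2)) ℤ)
    (hAn : ∀ i j, An i j =
      A (if (i : ℕ) < k0 + 2 then ⟨(i : ℕ), by omega⟩
          else ⟨a0 + (i : ℕ), by omega⟩)
        (if (j : ℕ) < k0 + 1 then ⟨(j : ℕ), by omega⟩
          else ⟨a0 + 1 + (j : ℕ), by omega⟩))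
    (AC : Matrix (Fin (a0 + b0 + 2)) (Fin (a0 + b0 + 2)) ℤ)
    (hAC : ∀ i j, AC i j =
      A (if h : (i : ℕ) = 0 then ⟨0, by omega⟩
          else if h1 : (i : ℕ) ≤ a0 + 1 then ⟨a0 + k0 + 2 - (i : ℕ), by omega⟩
          else ⟨k0 + (i : ℕ), by omega⟩)
        (if (j : ℕ) ≤ a0 then ⟨a0 + k0 + 1 - (j : ℕ), by omega⟩
          else ⟨k0 + 1 + (j : ℕ), by omega⟩))
    (p q s : ℤ) (hp : p = An.det) (hq : q = Am.det) (hs : s = AC.det)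
    (hCmunbal : q ≠ 0) (hCnunbal : p ≠ 0) (hCunbal : s ≠ 0)
    (rP : Fin (k0 + 1) → ℤ)
    (hrP : ∀ i, rP i =
      (AP.submatrix (fun t : Fin k0 => t.succ.castSucc) (Fin.succAbove i)).det)
    (rmP : Fin (a0 + 1) → ℤ)
    (hrmP : ∀ i, rmP i =
      (AmP.submatrix (fun t : Fin a0 => t.succ.castSucc) (Fin.succAbove i)).det)
    (rnP : Fin (b0 + 1) → ℤ)
    (hrnP : ∀ i, rnP i =
      (AnP.submatrix (fun t : Fin b0 => t.succ.castSucc) (Fin.succAbove i)).det)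
    (d : ℕ) (hd : d = Nat.gcd
      (Nat.gcd (Finset.univ.gcd fun i => (s * rP i).natAbs)
        (Finset.univ.gcd fun i => (p * rmP i).natAbs))
      (Finset.univ.gcd fun i => (q * rnP i).natAbs))
    (c : Fin (a0 + b0 + k0 + 3) → ℤ)
    (hc : ∀ t : Fin (a0 + b0 + k0 + 3), c t =
      if h1 : (t : ℕ) < k0 + 1 then
        ((-1 : ℤ) ^ (t : ℕ) * s * rP ⟨(t : ℕ), h1⟩) / (d : ℤ)
      else if h2 : (t : ℕ) < a0 + k0 + 2 then
        ((-1 : ℤ) ^ ((t : ℕ) + k0 + a0) * p *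
          rmP ⟨(t : ℕ) - (k0 + 1), by omega⟩) / (d : ℤ)
      else
        ((-1 : ℤ) ^ ((t : ℕ) + k0) * q *
          rnP ⟨(t : ℕ) - (a0 + k0 + 2), by omega⟩) / (d : ℤ)) :
    IsPrimitiveIn K I c ∧ I = Ideal.span {binom K c} := by
  obtain ⟨α, hα⟩ : ∃ α : ℕ → ℤ, ∀ j, α j =
      if h : j < a0 + b0 + k0 + 3 then A (endA ⟨j, h⟩) ⟨j, h⟩ else 1 := ⟨_, fun _ => rfl⟩
  obtain ⟨β, hβ⟩ : ∃ β : ℕ → ℤ, ∀ j, β j =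
      if h : j < a0 + b0 + k0 + 3 then A (endB ⟨j, h⟩) ⟨j, h⟩ else 1 := ⟨_, fun _ => rfl⟩
  have hfst : ∀ e, (endA e : ℕ) = thetaFst a0 k0 e := hendA
  have hsnd : ∀ e, (endB e : ℕ) = thetaSnd a0 b0 k0 e := hendB
  have hne : ∀ e, endA e ≠ endB e := by
    intro e h
    have h1 := hendA e
    have h2 := hendB e
    rw [h] at h1
    have he := e.isLt
    split_ifs at h1 h2 <;> omega
  have hst : ∀ e, src e ≠ tgt e := by
    intro e
    rw [hsrc, htgt]
    cases orient e
    · simpa using (hne e).symm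
    · simpa using hne e
  have hends : ∀ e, (src e = endA e ∧ tgt e = endB e) ∨ (src e = endB e ∧ tgt e = endA e) := by
    intro e
    rw [hsrc, htgt]
    cases orient e <;> simp
  have hpos : ∀ v e, endA e = v ∨ endB e = v → A v e ≠ 0 := by
    intro v e h
    rw [hA]
    have := hw v
    rcases hends e with ⟨h1, h2⟩ | ⟨h1, h2⟩ <;> rcases h with h | h <;>
      · rw [h1, h2, h]
        split_ifs <;> omega
  have hα0 : ∀ j, α j ≠ 0 := by
    intro j
    rw [hα]
    split_ifs with h
    · exact hpos _ _ (Or.inl rfl)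
    · exact one_ne_zero
  have hβ0 : ∀ j, β j ≠ 0 := by
    intro j
    rw [hβ]
    split_ifs with h
    · exact hpos _ _ (Or.inr rfl)
    · exact one_ne_zero
  have hAE : ∀ v e, A v e = thetaEntry a0 b0 k0 α β v e := by
    intro v e
    by_cases h1 : endA e = v
    · rw [thetaEntry_fst (by rw [← hfst, h1]), hα, dif_pos e.isLt, ← h1]
    by_cases h2 : endB e = v
    · rw [thetaEntry_snd (by rw [← hfst]; exact fun h => h1 (Fin.ext h)) (by rw [← hsnd, h2]),
        hβ, dif_pos e.isLt, ← h2]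
    · rw [thetaEntry_zero (by rw [← hfst]; exact fun h => h1 (Fin.ext h))
        (by rw [← hsnd]; exact fun h => h2 (Fin.ext h)), hA]
      rcases hends e with ⟨h3, h4⟩ | ⟨h3, h4⟩ <;> rw [h3, h4] <;> simp [h1, h2]
  have hqv : q = (∏ j ∈ range (k0 + 1), α j) * ∏ j ∈ range (a0 + 1), α (k0 + 1 + j) +
      (-1) ^ (a0 + k0 + 1) *
        ((∏ j ∈ range (k0 + 1), β j) * ∏ j ∈ range (a0 + 1), β (k0 + 1 + j)) := by
    rw [hq, det_cycle (a0 + k0) α β Am, ← Finset.prod_range_add, ← Finset.prod_range_add,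
      show k0 + 1 + (a0 + 1) = a0 + k0 + 2 by omega]
    intro i j
    have hi := i.isLt
    have hj := j.isLt
    rw [hAm, hAE, thetaEntry, thetaFst, thetaSnd]
    simp only [Fin.val_castLE]
    split_ifs <;> first | rfl | omega
  have hpv : p = (∏ j ∈ range (k0 + 1), α j) * ∏ j ∈ range (b0 + 1), α (a0 + k0 + 2 + j) +
      (-1) ^ (b0 + k0 + 1) *
        ((∏ j ∈ range (k0 + 1), β j) * ∏ j ∈ range (b0 + 1), β (a0 + k0 + 2 + j)) := by
    have hsplit : ∀ γ : ℕ → ℤ, ∏ j ∈ range (b0 + k0 + 2),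
        γ (if j < k0 + 1 then j else a0 + 1 + j) =
        (∏ j ∈ range (k0 + 1), γ j) * ∏ j ∈ range (b0 + 1), γ (a0 + k0 + 2 + j) := by
      intro γ
      rw [show b0 + k0 + 2 = k0 + 1 + (b0 + 1) by omega, Finset.prod_range_add]
      congr 1
      · refine Finset.prod_congr rfl fun j hj => ?_
        rw [if_pos (Finset.mem_range.1 hj)]
      · refine Finset.prod_congr rfl fun j _ => ?_
        rw [if_neg (by omega)]
        congr 1
        omega
    rw [hp, det_cycle (b0 + k0) (fun j => α (if j < k0 + 1 then j else a0 + 1 + j))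
      (fun j => β (if j < k0 + 1 then j else a0 + 1 + j)) An, hsplit, hsplit]
    intro i j
    have hi := i.isLt
    have hj := j.isLt
    rw [hAn, hAE, thetaEntry, thetaFst, thetaSnd]
    simp only [apply_ite Fin.val]
    split_ifs <;> first | rfl | omega
  have hsv : s = (∏ j ∈ range (a0 + 1), β (k0 + 1 + j)) *
        ∏ j ∈ range (b0 + 1), α (a0 + k0 + 2 + j) +
      (-1) ^ (a0 + b0 + 1) * ((∏ j ∈ range (a0 + 1), α (k0 + 1 + j)) *
        ∏ j ∈ range (b0 + 1), β (a0 + k0 + 2 + j)) := by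
    have hsplit : ∀ γ δ : ℕ → ℤ, ∏ j ∈ range (a0 + b0 + 2),
        (if j ≤ a0 then γ (a0 + k0 + 1 - j) else δ (k0 + 1 + j)) =
        (∏ j ∈ range (a0 + 1), γ (k0 + 1 + j)) *
          ∏ j ∈ range (b0 + 1), δ (a0 + k0 + 2 + j) := by
      intro γ δ
      rw [show a0 + b0 + 2 = a0 + 1 + (b0 + 1) by omega, Finset.prod_range_add]
      congr 1
      · rw [← Finset.prod_range_reflect]
        refine Finset.prod_congr rfl fun j hj => ?_
        have := Finset.mem_range.1 hj
        rw [if_pos (by omega)]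
        congr 1
        omega
      · refine Finset.prod_congr rfl fun j _ => ?_
        rw [if_neg (by omega)]
        congr 1
        omega
    rw [hs, det_cycle (a0 + b0)
      (fun j => if j ≤ a0 then β (a0 + k0 + 1 - j) else α (k0 + 1 + j))
      (fun j => if j ≤ a0 then α (a0 + k0 + 1 - j) else β (k0 + 1 + j)) AC, hsplit, hsplit]
    intro i j
    have hi := i.isLt
    have hj := j.isLt
    rw [hAC, hAE]
    refine thetaEntry_outer hi hj ?_ ?_
    · split_ifs with h1 h2
      · exact Or.inl ⟨h1, rfl⟩
      · exact Or.inr (Or.inl ⟨by omega, h2, rfl⟩)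
      · exact Or.inr (Or.inr ⟨by omega, rfl⟩)
    · split_ifs with h1
      · exact Or.inl ⟨h1, rfl⟩
      · exact Or.inr ⟨by omega, rfl⟩
  have hrPv : ∀ i, rP i = pathCoeff α β k0 i := by
    intro i
    rw [hrP, ← det_path k0 i α β (AP.submatrix (fun t : Fin k0 => t.succ.castSucc) id)]
    · rfl
    · intro t j
      have ht := t.isLt
      have hj := j.isLt
      rw [Matrix.submatrix_apply, hAP, hAE, thetaEntry, thetaFst, thetaSnd]
      simp only [Fin.val_castLE, Fin.val_castSucc, Fin.val_succ, id]
      split_ifs <;> first | rfl | omega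
  have hrmPv : ∀ i, rmP i =
      pathCoeff (fun j => α (k0 + 1 + j)) (fun j => β (k0 + 1 + j)) a0 i := by
    intro i
    rw [hrmP, ← det_path a0 i _ _ (AmP.submatrix (fun t : Fin a0 => t.succ.castSucc) id)]
    · rfl
    · intro t j
      have ht := t.isLt
      have hj := j.isLt
      rw [Matrix.submatrix_apply, hAmP, hAE,
        dif_neg (by rw [Fin.val_castSucc, Fin.val_succ]; omega)]
      exact thetaEntry_left ht hj
  have hrnPv : ∀ i, rnP i =
      pathCoeff (fun j => α (a0 + k0 + 2 + j)) (fun j => β (a0 + k0 + 2 + j)) b0 i := by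
    intro i
    rw [hrnP, ← det_path b0 i _ _ (AnP.submatrix (fun t : Fin b0 => t.succ.castSucc) id)]
    · rfl
    · intro t j
      have ht := t.isLt
      have hj := j.isLt
      rw [Matrix.submatrix_apply, hAnP, hAE,
        dif_neg (by rw [Fin.val_castSucc, Fin.val_succ]; omega),
        dif_neg (by rw [Fin.val_castSucc, Fin.val_succ]; omega)]
      exact thetaEntry_right ht
  obtain ⟨x, hx⟩ : ∃ x : ℕ → ℤ, ∀ t, x t =
      if h1 : t < k0 + 1 then (-1 : ℤ) ^ t * s * pathCoeff α β k0 t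
      else if h2 : t < a0 + k0 + 2 then (-1 : ℤ) ^ (t + k0 + a0) * p *
        pathCoeff (fun j => α (k0 + 1 + j)) (fun j => β (k0 + 1 + j)) a0 (t - (k0 + 1))
      else (-1 : ℤ) ^ (t + k0) * q *
        pathCoeff (fun j => α (a0 + k0 + 2 + j)) (fun j => β (a0 + k0 + 2 + j)) b0
          (t - (a0 + k0 + 2)) := ⟨_, fun _ => rfl⟩
  have hxP : ∀ t ≤ k0, x t = (-1) ^ t * s * pathCoeff α β k0 t := fun t ht => by
    rw [hx, dif_pos (by omega)]
  have hxl : ∀ t ≤ a0, x (k0 + 1 + t) = (-1) ^ (t + 1 + a0) * p *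
      pathCoeff (fun j => α (k0 + 1 + j)) (fun j => β (k0 + 1 + j)) a0 t := fun t ht => by
    rw [hx, dif_neg (by omega), dif_pos (by omega), Nat.add_sub_cancel_left,
      show k0 + 1 + t + k0 + a0 = t + 1 + a0 + 2 * k0 by omega, pow_add _ _ (2 * k0), pow_mul]
    simp
  have hxr : ∀ t ≤ b0, x (a0 + k0 + 2 + t) = (-1) ^ (t + a0) * q *
      pathCoeff (fun j => α (a0 + k0 + 2 + j)) (fun j => β (a0 + k0 + 2 + j)) b0 t :=
    fun t ht => by
    rw [hx, dif_neg (by omega), dif_neg (by omega), Nat.add_sub_cancel_left,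
      show a0 + k0 + 2 + t + k0 = t + a0 + 2 * (k0 + 1) by omega, pow_add _ _ (2 * (k0 + 1)),
      pow_mul]
    simp
  have hxrel : ThetaRelation a0 b0 k0 α β x := .of_pathCoeff hqv hpv hsv hxP hxl hxr
  have hx0 : x 0 ≠ 0 := by
    rw [hxP 0 (Nat.zero_le _)]
    simpa using ⟨hCunbal, pathCoeff_ne_zero hα0 hβ0 0⟩
  have hnatP : ∀ i : Fin (k0 + 1), (x i).natAbs = (s * rP i).natAbs := fun i => by
    rw [hxP _ (by omega), hrPv, mul_assoc, Int.natAbs_mul]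
    simp [Int.natAbs_pow]
  have hnatl : ∀ i : Fin (a0 + 1), (x (k0 + 1 + i)).natAbs = (p * rmP i).natAbs := fun i => by
    rw [hxl _ (by omega), hrmPv, mul_assoc, Int.natAbs_mul]
    simp
  have hnatr : ∀ i : Fin (b0 + 1), (x (a0 + k0 + 2 + i)).natAbs = (q * rnP i).natAbs :=
    fun i => by
    rw [hxr _ (by omega), hrnPv, mul_assoc, Int.natAbs_mul]
    simp
  have hdvd : ∀ t < a0 + b0 + k0 + 3, (d : ℤ) ∣ x t := by
    intro t ht
    rw [Int.natCast_dvd, hd]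
    by_cases h1 : t < k0 + 1
    · rw [hnatP ⟨t, h1⟩]
      exact ((Nat.gcd_dvd_left _ _).trans (Nat.gcd_dvd_left _ _)).trans
        (Finset.gcd_dvd (f := fun i => (s * rP i).natAbs) (Finset.mem_univ _))
    by_cases h2 : t < a0 + k0 + 2
    · obtain ⟨j, rfl⟩ := Nat.exists_eq_add_of_le (show k0 + 1 ≤ t by omega)
      rw [hnatl ⟨j, by omega⟩]
      exact ((Nat.gcd_dvd_left _ _).trans (Nat.gcd_dvd_right _ _)).trans
        (Finset.gcd_dvd (f := fun i => (p * rmP i).natAbs) (Finset.mem_univ _))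
    · obtain ⟨j, rfl⟩ := Nat.exists_eq_add_of_le (show a0 + k0 + 2 ≤ t by omega)
      rw [hnatr ⟨j, by omega⟩]
      exact (Nat.gcd_dvd_right _ _).trans
        (Finset.gcd_dvd (f := fun i => (q * rnP i).natAbs) (Finset.mem_univ _))
  have hdvd_mul : ∀ D B : ℕ, (∀ t < a0 + b0 + k0 + 3, D ∣ B * (x t).natAbs) → D ∣ B * d := by
    intro D B h
    rw [hd, ← Nat.gcd_mul_left, ← Nat.gcd_mul_left]
    have hg : ∀ {n : ℕ} (f : Fin n → ℕ), B * Finset.univ.gcd f =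
        Finset.univ.gcd fun i => B * f i := fun f => by
      rw [Finset.gcd_mul_left]; simp
    rw [hg, hg, hg]
    refine Nat.dvd_gcd (Nat.dvd_gcd ?_ ?_) ?_
    · refine Finset.dvd_gcd fun i _ => ?_
      rw [← hnatP]
      exact h _ (by omega)
    · refine Finset.dvd_gcd fun i _ => ?_
      rw [← hnatl]
      exact h _ (by omega)
    · refine Finset.dvd_gcd fun i _ => ?_
      rw [← hnatr]
      exact h _ (by omega)
  have hd0 : (d : ℤ) ≠ 0 := fun h => by
    have := hdvd 0 (by omega)
    rw [h, zero_dvd_iff] at this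
    exact hx0 this
  have hxc : ∀ t : Fin (a0 + b0 + k0 + 3), x t = d * c t := by
    intro t
    have : c t = x t / d := by
      rw [hc, hx]
      simp only [hrPv, hrmPv, hrnPv]
      split_ifs <;> rfl
    rw [this, Int.mul_ediv_cancel' (hdvd t t.isLt)]
  have hcne : c ≠ 0 := fun h => by
    have := hxc 0
    rw [h] at this
    exact hx0 (by simpa using this)
  have hkerA : ∀ b : Fin (a0 + b0 + k0 + 3) → ℤ, ∀ y : ℕ → ℤ, (∀ e, y e.val = b e) →
      ((∀ v, ∑ e, A v e * b e = 0) ↔ ThetaRelation a0 b0 k0 α β y) := by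
    intro b y hy
    rw [← forall_sum_thetaEntry_eq_zero_iff, Fin.forall_iff]
    refine forall₂_congr fun v hv => ?_
    rw [← Fin.sum_univ_eq_sum_range (fun e => thetaEntry a0 b0 k0 α β v e * y e)]
    simp only [hAE, hy]
  have hker : ∀ b : Fin (a0 + b0 + k0 + 3) → ℤ,
      (∀ v, ∑ e, A v e * b e = 0) ↔ ∃ z : ℤ, ∀ e, b e = z * c e := by
    intro b
    constructor
    · intro hb
      obtain ⟨y, hy⟩ : ∃ y : ℕ → ℤ, ∀ e : Fin (a0 + b0 + k0 + 3), y e = b e :=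
        ⟨fun j => if h : j < a0 + b0 + k0 + 3 then b ⟨j, h⟩ else 0, fun e => by simp⟩
      have hyrel := (hkerA b y hy).1 hb
      have hprop : ∀ j < a0 + b0 + k0 + 3, x 0 * y j = y 0 * x j := by
        intro j hj
        refine sub_eq_zero.1 ((hyrel.smul_sub_smul hxrel (x 0) (y 0)).eq_zero hα0 hβ0
          (hsv ▸ hCunbal) ?_ hj)
        ring
      have h1 : x 0 ∣ y 0 * d := by
        rw [← Int.natAbs_dvd_natAbs, Int.natAbs_mul, Int.natAbs_natCast]
        refine hdvd_mul _ _ fun t ht => ?_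
        rw [← Int.natAbs_mul, Int.natAbs_dvd_natAbs]
        exact ⟨y t, (hprop t ht).symm⟩
      obtain ⟨z, hz⟩ := h1
      refine ⟨z, fun e => mul_left_cancel₀ hx0 ?_⟩
      rw [← hy, hprop e e.isLt, hxc e]
      linear_combination c e * hz
    · rintro ⟨z, hz⟩ v
      have h1 := (hkerA (fun e => x e) x fun _ => rfl).2 hxrel v
      simp only [hxc] at h1
      apply mul_left_cancel₀ hd0
      rw [mul_zero, ← mul_zero z, ← h1, Finset.mul_sum, Finset.mul_sum]
      refine Finset.sum_congr rfl fun e _ => ?_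
      rw [hz]
      ring
  refine isPrimitiveIn_and_ker_eq_span_binom
    (fun e => Finsupp.single (src e) 1 + Finsupp.single (tgt e) (w (tgt e))) c hcne ?_ I ?_
  · intro b
    rw [← hker]
    refine forall_congr' fun v => ?_
    have : ∀ e, (((Finsupp.single (src e) 1 + Finsupp.single (tgt e) (w (tgt e)) :
        Fin (a0 + b0 + k0 + 2) →₀ ℕ) v : ℕ) : ℤ) = A v e := by
      intro e
      rw [hA, Finsupp.add_apply, Finsupp.single_apply, Finsupp.single_apply]
      by_cases h1 : src e = v
      · have h2 : tgt e ≠ v := fun h => hst e (h1.trans h.symm)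
        simp [h1, h2]
      · by_cases h2 : tgt e = v <;> simp [h1, h2]
    simp only [this]
  · have hX : ∀ e, (X (src e) * X (tgt e) ^ w (tgt e) :
        MvPolynomial (Fin (a0 + b0 + k0 + 2)) K) =
        monomial (Finsupp.single (src e) 1 + Finsupp.single (tgt e) (w (tgt e))) 1 := fun e => by
      rw [X_pow_eq_monomial, X, monomial_mul, one_mul]
    rw [hI, funext hX]
end
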